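/- For every irrational number α there exists an area-preserving NICIS homeomorphism of the closed annulus with rotation number α which is moreover ergodic. Precisely: there exist a homeomorphism f of 𝔸 = (ℝ/ℤ)×[-1,1] preserving the product of Haar measure on ℝ/ℤ and Lebesgue measure on [-1,1], and a lift f̃ of f, such that: f admits no nonempty compact f-invariant subset contained in the interior (ℝ/ℤ)×(-1,1); f is ergodic with respect to the (normalized) area measure; and for every f-invariant Borel probability measure μ on 𝔸 one has ∫_𝔸 (p∘f̃ − p) dμ = α. -/

import Mathlib

open MeasureTheory Set

attribute [local instance] MeasureTheory.Measure.Subtype.measureSpace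

noncomputable section

/-- The closed annulus `𝔸 = (ℝ/ℤ) × [-1,1]`. -/
abbrev Annulus := AddCircle (1 : ℝ) × (Set.Icc (-1 : ℝ) 1)

/-- The universal cover `ℝ × [-1,1]` of the closed annulus. -/
abbrev AnnulusCover := ℝ × (Set.Icc (-1 : ℝ) 1)

/-- The covering projection `ℝ × [-1,1] → (ℝ/ℤ) × [-1,1]`. -/
def annulusProj (z : AnnulusCover) : Annulus := ((z.1 : AddCircle (1 : ℝ)), z.2)

/-- The interior `(ℝ/ℤ) × (-1,1)` of the closed annulus. -/
def annulusInt : Set Annulus := {z | -1 < (z.2 : ℝ) ∧ (z.2 : ℝ) < 1}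

/-- The upper boundary circle `(ℝ/ℤ) × {1}`. -/
def annulusBdryPlus : Set Annulus := {z | (z.2 : ℝ) = 1}

/-- `ft` is a lift of the homeomorphism `f` of the annulus: it commutes with the deck
transformation `(x,y) ↦ (x+1,y)` and descends to `f`. -/
def IsLift (f : Annulus ≃ₜ Annulus) (ft : AnnulusCover ≃ₜ AnnulusCover) : Prop :=
  (∀ z : AnnulusCover, ft (z.1 + 1, z.2) = ((ft z).1 + 1, (ft z).2)) ∧
  (∀ z : AnnulusCover, f (annulusProj z) = annulusProj (ft z))

/-- `f` admits no nonempty compact invariant set contained in the interior of the annulus. -/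
def NICIS (f : Annulus ≃ₜ Annulus) : Prop :=
  ¬ ∃ K : Set Annulus, K.Nonempty ∧ IsCompact K ∧ f '' K = K ∧ K ⊆ annulusInt

theorem unitAddCircle_coe_eq_iff {x y : ℝ} :
    (x : AddCircle (1 : ℝ)) = y ↔ ∃ n : ℤ, x = y + n := by
  rw [← sub_eq_zero, ← AddCircle.coe_sub, AddCircle.coe_eq_zero_iff]
  refine exists_congr fun n => ?_
  rw [zsmul_eq_mul, mul_one, eq_comm, sub_eq_iff_eq_add, add_comm]

theorem denseRange_nsmul_of_irrational {α : ℝ} (hα : Irrational α) :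
    DenseRange (fun n : ℕ => n • (α : AddCircle (1 : ℝ))) := by
  rw [← denseRange_zsmul_iff_nsmul]
  exact AddCircle.denseRange_zsmul_coe_iff.2 (by simpa using hα)

theorem Irrational.mul_sub_int_ne_zero {α : ℝ} (hα : Irrational α) {m : ℕ} (hm : 1 ≤ m) (r : ℤ) :
    (m : ℝ) * α - r ≠ 0 :=
  sub_ne_zero.2 ((hα.natCast_mul (by omega : m ≠ 0)).ne_int r)

/-- Positive multiples of an irrational number meet every integer-free interval modulo `1`. -/
theorem exists_pos_mul_sub_int_mem_Ioo {α : ℝ} (hα : Irrational α) {x y : ℝ} (hxy : x < y)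
    (h0 : ∀ n : ℤ, (n : ℝ) ∉ Ioo x y) :
    ∃ (m : ℕ) (r : ℤ), 1 ≤ m ∧ (m : ℝ) * α - r ∈ Ioo x y := by
  have ho : IsOpen (((↑) : ℝ → AddCircle (1 : ℝ)) '' Ioo x y) :=
    QuotientAddGroup.isOpenMap_coe _ isOpen_Ioo
  obtain ⟨m, t, ht, hmt⟩ := (denseRange_nsmul_of_irrational hα).exists_mem_open ho
    ((nonempty_Ioo.2 hxy).image _)
  have h1 : ((m * α : ℝ) : AddCircle (1 : ℝ)) = (t : AddCircle (1 : ℝ)) := by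
    rw [hmt, ← AddCircle.coe_nsmul, nsmul_eq_mul]
  obtain ⟨k, hk⟩ := unitAddCircle_coe_eq_iff.1 h1
  refine ⟨m, k, ?_, by rwa [hk, add_sub_cancel_right]⟩
  rcases Nat.eq_zero_or_pos m with rfl | h
  · refine absurd ht ?_
    have : t = ((-k : ℤ) : ℝ) := by push_cast at hk ⊢; linarith
    rw [this]; exact h0 _
  · exact h

/-- A pair of consecutive best one-sided approximations of an irrational number, with errors
`a` from above and `-b` from below. -/
structure BestApprox (α : ℝ) where
  (q q' : ℕ) (p p' : ℤ) (a b : ℝ)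
  a_pos : 0 < a
  b_pos : 0 < b
  q_pos : 1 ≤ q
  q'_pos : 1 ≤ q'
  q_eq : (q : ℝ) * α - p = a
  q'_eq : (q' : ℝ) * α - p' = -b
  right_min : ∀ m : ℕ, 1 ≤ m → m ≤ max q q' → ∀ r : ℤ, (m : ℝ) * α - r ∉ Ioo 0 a
  left_min : ∀ m : ℕ, 1 ≤ m → m ≤ max q q' → ∀ r : ℤ, (m : ℝ) * α - r ∉ Ioo (-b) 0

theorem exists_bestApprox {α : ℝ} (hα : Irrational α) {ε : ℝ} (hε : 0 < ε) :
    ∃ B : BestApprox α, B.a < ε ∧ B.b < ε := by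
  have hinteg : ∀ n : ℤ, (n : ℝ) ∉ Ioo (0 : ℝ) (min ε 1) := by
    rintro n ⟨h1, h2⟩
    have h3 := h2.trans_le (min_le_right _ _)
    norm_cast at h1 h3
    omega
  have hinteg' : ∀ n : ℤ, (n : ℝ) ∉ Ioo (1 - min ε 1) (1 : ℝ) := by
    rintro n ⟨h1, h2⟩
    refine hinteg (1 - n) ⟨by push_cast; linarith, by push_cast; linarith⟩
  have hmin : 0 < min ε 1 := lt_min hε one_pos
  obtain ⟨m₁, r₁, hm₁, h₁⟩ := exists_pos_mul_sub_int_mem_Ioo hα hmin hinteg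
  obtain ⟨m₂, r₂, hm₂, h₂⟩ := exists_pos_mul_sub_int_mem_Ioo hα
    (by linarith : 1 - min ε 1 < 1) hinteg'
  have hle1 : min ε 1 ≤ 1 := min_le_right _ _
  have hleε : min ε 1 ≤ ε := min_le_left _ _
  have fr : ∀ (m : ℕ) (r : ℤ), 0 ≤ (m : ℝ) * α - r → (m : ℝ) * α - r < 1 →
      Int.fract ((m : ℝ) * α) = (m : ℝ) * α - r := fun m r h h' =>
    Int.fract_eq_iff.2 ⟨h, h', r, by ring⟩
  let N := max m₁ m₂
  have hne : (Finset.Icc 1 N).Nonempty := ⟨m₁, Finset.mem_Icc.2 ⟨hm₁, le_max_left _ _⟩⟩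
  obtain ⟨q, hq, hqmin⟩ := Finset.exists_min_image (Finset.Icc 1 N)
    (fun m : ℕ => Int.fract ((m : ℝ) * α)) hne
  obtain ⟨q', hq', hqmax⟩ := Finset.exists_max_image (Finset.Icc 1 N)
    (fun m : ℕ => Int.fract ((m : ℝ) * α)) hne
  rw [Finset.mem_Icc] at hq hq'
  have hmem : ∀ m : ℕ, 1 ≤ m → m ≤ max q q' → m ∈ Finset.Icc 1 N := fun m h h' =>
    Finset.mem_Icc.2 ⟨h, h'.trans (max_le hq.2 hq'.2)⟩
  have ha : 0 < Int.fract ((q : ℝ) * α) :=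
    lt_of_le_of_ne (Int.fract_nonneg _) (hα.mul_sub_int_ne_zero hq.1 _).symm
  refine ⟨⟨q, q', ⌊(q : ℝ) * α⌋, ⌊(q' : ℝ) * α⌋ + 1, Int.fract ((q : ℝ) * α),
    1 - Int.fract ((q' : ℝ) * α), ha, sub_pos.2 (Int.fract_lt_one _), hq.1, hq'.1, rfl, ?_, ?_, ?_⟩,
    ?_, ?_⟩
  · rw [Int.fract]; push_cast; ring
  · rintro m hm hm' r ⟨h, h'⟩
    have := hqmin m (hmem m hm hm')
    simp only [fr m r h.le (h'.trans (Int.fract_lt_one _))] at this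
    linarith
  · rintro m hm hm' r ⟨h, h'⟩
    have := hqmax m (hmem m hm hm')
    have h0 := Int.fract_nonneg ((q' : ℝ) * α)
    have h3 := fr m (r - 1) (by push_cast; linarith) (by push_cast; linarith)
    simp only [h3] at this
    push_cast at this
    linarith
  · have := hqmin m₁ (Finset.mem_Icc.2 ⟨hm₁, le_max_left _ _⟩)
    simp only [fr m₁ r₁ h₁.1.le (h₁.2.trans_le hle1)] at this
    exact lt_of_le_of_lt this (h₁.2.trans_le hleε)
  · have := hqmax m₂ (Finset.mem_Icc.2 ⟨hm₂, le_max_right _ _⟩)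
    simp only [fr m₂ r₂ (by linarith [h₂.1]) h₂.2] at this
    simp only
    linarith [h₂.1]

namespace BestApprox

variable {α : ℝ} (B : BestApprox α)

theorem add_le_one (hα : Irrational α) : B.a + B.b ≤ 1 := by
  by_contra! h
  have hq := B.q_pos.trans (le_max_left B.q B.q')
  have hf := Int.fract_lt_one (((1 : ℕ) : ℝ) * α)
  have h0 : 0 < Int.fract (((1 : ℕ) : ℝ) * α) :=
    lt_of_le_of_ne (Int.fract_nonneg _) (hα.mul_sub_int_ne_zero le_rfl _).symm
  have h1 := B.right_min 1 le_rfl hq ⌊((1 : ℕ) : ℝ) * α⌋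
  have h2 := B.left_min 1 le_rfl hq (⌊((1 : ℕ) : ℝ) * α⌋ + 1)
  rw [Int.fract] at hf h0
  simp only [mem_Ioo, not_and, not_lt] at h1 h2
  have := h1 h0
  push_cast at *
  linarith [h2 (by linarith)]

theorem forward_notMem (hα : Irrational α) {m : ℕ} (hm : 1 ≤ m) (hmq : m < B.q) {r : ℤ}
    {x : ℝ} (hx : (m : ℝ) * α - r = x) : x ∉ Ioo (-B.b) (B.a + B.b) := by
  subst hx
  rintro ⟨h1, h2⟩
  have hle : m ≤ max B.q B.q' := hmq.le.trans (le_max_left _ _)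
  have h3 := B.left_min m hm hle r
  have h4 := B.right_min m hm hle r
  have h5 := hα.mul_sub_int_ne_zero hm r
  have h6 := B.left_min (B.q - m) (by omega) ((Nat.sub_le _ _).trans (le_max_left _ _)) (B.p - r)
  have h7 := hα.mul_sub_int_ne_zero (by omega : 1 ≤ B.q - m) (B.p - r)
  have hq := B.q_eq
  push_cast [Nat.cast_sub hmq.le] at h6 h7
  simp only [mem_Ioo, not_and, not_lt] at h3 h4 h6
  rcases lt_or_gt_of_ne h5 with h | h
  · linarith [h3 h1]
  · have := h4 h
    rcases this.eq_or_lt with h8 | h8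
    · exact h7 (by linarith)
    · linarith [h6 (by linarith)]

theorem backward_notMem (hα : Irrational α) {m : ℕ} (hm : 1 ≤ m) (hmq : m < B.q') {r : ℤ}
    {x : ℝ} (hx : (m : ℝ) * α - r = x) : x ∉ Ioo (-(B.a + B.b)) B.a := by
  subst hx
  rintro ⟨h1, h2⟩
  have hle : m ≤ max B.q B.q' := hmq.le.trans (le_max_right _ _)
  have h3 := B.left_min m hm hle r
  have h4 := B.right_min m hm hle r
  have h5 := hα.mul_sub_int_ne_zero hm r
  have h6 := B.right_min (B.q' - m) (by omega) ((Nat.sub_le _ _).trans (le_max_right _ _))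
    (B.p' - r)
  have h7 := hα.mul_sub_int_ne_zero (by omega : 1 ≤ B.q' - m) (B.p' - r)
  have hq := B.q'_eq
  push_cast [Nat.cast_sub hmq.le] at h6 h7
  simp only [mem_Ioo, not_and, not_lt] at h3 h4 h6
  rcases lt_or_gt_of_ne h5 with h | h
  · have : (m : ℝ) * α - r ≤ -B.b := by
      by_contra! h8
      linarith [h3 h8]
    rcases this.eq_or_lt with h8 | h8
    · exact h7 (by linarith)
    · linarith [h6 (by linarith)]
  · linarith [h4 h]

/-- Left end of a level of one of the two towers over `[0, b)` and `[b, a + b)`. -/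
def left : Fin B.q ⊕ Fin B.q' → ℝ := Sum.elim (fun j => j * α) (fun j => B.b + j * α)

/-- Width of the levels of the two towers. -/
def width : Fin B.q ⊕ Fin B.q' → ℝ := Sum.elim (fun _ => B.b) (fun _ => B.a)

theorem left_add_ne (hα : Irrational α) {i k : Fin B.q ⊕ Fin B.q'} (hik : i ≠ k) {u v : ℝ}
    (hu : u ∈ Icc 0 (B.width i)) (hv : v ∈ Ioo 0 (B.width k)) (r : ℤ) :
    B.left i + u ≠ B.left k + v + r := by
  intro h
  have ha := B.a_pos
  have hb := B.b_pos
  have hab := B.add_le_one hα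
  have hcast : ∀ {m n : ℕ}, m < n → ((n - m : ℕ) : ℝ) = n - m := fun h => Nat.cast_sub h.le
  have key : ∀ {m n : ℕ} (r : ℤ) {t : ℝ}, (m : ℝ) * α = n * α + t + r →
      (m = n → t = -r) ∧ (n < m → ((m - n : ℕ) : ℝ) * α - r = t) ∧
      (m < n → ((n - m : ℕ) : ℝ) * α - (-r : ℤ) = -t) := by
    intro m n r t h
    refine ⟨fun e => ?_, fun e => ?_, fun e => ?_⟩
    · subst e; linarith
    · rw [hcast e]; linarith
    · rw [hcast e]; push_cast; linarith
  rcases i with i | i <;> rcases k with k | k <;>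
    simp only [left, width, Sum.elim_inl, Sum.elim_inr, mem_Icc, mem_Ioo] at h hu hv
  · obtain ⟨-, h2, h3⟩ := key (m := i) (n := k) (t := v - u) r (by linarith)
    have hne : (i : ℕ) ≠ k := fun e => hik (by rw [Fin.ext e])
    rcases lt_or_gt_of_ne hne with e | e
    · exact B.forward_notMem hα (by omega) (by omega) (h3 e) ⟨by linarith, by linarith⟩
    · exact B.forward_notMem hα (by omega) (by omega) (h2 e) ⟨by linarith, by linarith⟩
  · obtain ⟨h1, h2, h3⟩ := key (m := i) (n := k) (t := B.b + v - u) r (by linarith)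
    rcases lt_trichotomy (i : ℕ) k with e | e | e
    · exact B.backward_notMem hα (by omega) (by omega) (h3 e) ⟨by linarith, by linarith⟩
    · have h4 := h1 e
      have h5 : (0 : ℝ) < (-r : ℤ) := by push_cast; linarith
      have h6 : ((-r : ℤ) : ℝ) < 1 := by push_cast; linarith
      norm_cast at h5 h6
      omega
    · exact B.forward_notMem hα (by omega) (by omega) (h2 e) ⟨by linarith, by linarith⟩
  · obtain ⟨h1, h2, h3⟩ := key (m := i) (n := k) (t := v - (B.b + u)) r (by linarith)
    rcases lt_trichotomy (i : ℕ) k with e | e | e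
    · exact B.forward_notMem hα (by omega) (by omega) (h3 e) ⟨by linarith, by linarith⟩
    · have h4 := h1 e
      have h5 : (0 : ℝ) < r := by linarith
      have h6 : (r : ℝ) < 1 := by linarith
      norm_cast at h5 h6
      omega
    · exact B.backward_notMem hα (by omega) (by omega) (h2 e) ⟨by linarith, by linarith⟩
  · obtain ⟨-, h2, h3⟩ := key (m := i) (n := k) (t := v - u) r (by linarith)
    have hne : (i : ℕ) ≠ k := fun e => hik (by rw [Fin.ext e])
    rcases lt_or_gt_of_ne hne with e | e
    · exact B.backward_notMem hα (by omega) (by omega) (h3 e) ⟨by linarith, by linarith⟩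
    · exact B.backward_notMem hα (by omega) (by omega) (h2 e) ⟨by linarith, by linarith⟩

theorem sum_width_eq_int : ∑ i, B.width i = ((B.q * B.p' - B.q' * B.p : ℤ) : ℝ) := by
  have h1 := B.q_eq
  have h2 := B.q'_eq
  simp only [Fintype.sum_sum_type, width, Sum.elim_inl, Sum.elim_inr, Finset.sum_const,
    Finset.card_univ, Fintype.card_fin, nsmul_eq_mul]
  push_cast
  have e1 : (B.p : ℝ) = B.q * α - B.a := by linarith
  have e2 : (B.p' : ℝ) = B.q' * α + B.b := by linarith
  rw [e1, e2]
  ring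

end BestApprox

theorem integral_Icc_subtype (g : ℝ → ℝ) :
    ∫ y : Icc (-1 : ℝ) 1, g y = ∫ y in (-1 : ℝ)..1, g y := by
  rw [intervalIntegral.integral_of_le (by norm_num), ← integral_Icc_eq_integral_Ioc,
    ← integral_subtype measurableSet_Icc]

/-- The open arc of length `w` starting at `c`. -/
def openArc (c w : ℝ) : Set (AddCircle (1 : ℝ)) := ((↑) : ℝ → AddCircle (1 : ℝ)) '' Ioo c (c + w)

theorem isOpen_openArc (c w : ℝ) : IsOpen (openArc c w) :=
  QuotientAddGroup.isOpenMap_coe _ isOpen_Ioo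

theorem coe_mem_openArc_iff {c w t : ℝ} (hw : w ≤ 1) (ht : t ∈ Ioc c (c + 1)) :
    (t : AddCircle (1 : ℝ)) ∈ openArc c w ↔ t ∈ Ioo c (c + w) := by
  refine ⟨?_, fun h => ⟨t, h, rfl⟩⟩
  rintro ⟨t', ht', h⟩
  have := (AddCircle.coe_eq_coe_iff_of_mem_Ioc (p := (1 : ℝ)) (a := c)
    (⟨ht'.1, by linarith [ht'.2]⟩ : t' ∈ Ioc c (c + 1)) ht).1 h
  rwa [← this]

theorem volume_openArc (c : ℝ) {w : ℝ} (hw : w ≤ 1) :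
    volume (openArc c w) = ENNReal.ofReal w := by
  rw [AddCircle.add_projection_respects_measure 1 c (isOpen_openArc c w).measurableSet]
  have : (QuotientAddGroup.mk : ℝ → AddCircle (1 : ℝ)) ⁻¹' openArc c w ∩ Ioc c (c + 1) =
      Ioo c (c + w) := by
    ext t
    constructor
    · rintro ⟨h, ht⟩
      exact (coe_mem_openArc_iff hw ht).1 h
    · exact fun h => ⟨⟨t, h, rfl⟩, h.1, by linarith [h.2]⟩
  rw [this, Real.volume_Ioo, add_sub_cancel_left]

theorem setIntegral_openArc (c : ℝ) {w : ℝ} (hw0 : 0 < w) (hw : w ≤ 1)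
    (g : AddCircle (1 : ℝ) → ℝ) :
    ∫ x in openArc c w, g x =
      w / 2 * ∫ X : Icc (-1 : ℝ) 1, g ((c + w * (1 + X) / 2 : ℝ) : AddCircle (1 : ℝ)) := by
  rw [← integral_indicator (isOpen_openArc c w).measurableSet, ← AddCircle.integral_preimage 1 c]
  have : ∫ t in Ioc c (c + 1), (openArc c w).indicator g (t : AddCircle (1 : ℝ)) =
      ∫ t in Ioc c (c + 1), (Ioo c (c + w)).indicator (fun t : ℝ => g t) t := by
    refine setIntegral_congr_fun measurableSet_Ioc fun t ht => ?_
    simp only [indicator, coe_mem_openArc_iff hw ht]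
  have hsub : Ioo c (c + w) ⊆ Ioc c (c + 1) := fun t ht => ⟨ht.1, by linarith [ht.2]⟩
  rw [this, setIntegral_indicator measurableSet_Ioo, inter_eq_right.2 hsub,
    ← integral_Ioc_eq_integral_Ioo, ← intervalIntegral.integral_of_le (by linarith),
    integral_Icc_subtype (fun X => g ((c + w * (1 + X) / 2 : ℝ) : AddCircle (1 : ℝ)))]
  have h := intervalIntegral.integral_comp_mul_add (a := -1) (b := 1)
    (fun t : ℝ => g (t : AddCircle (1 : ℝ))) (half_pos hw0).ne' (c + w / 2)
  have e : ∀ X : ℝ, c + w * (1 + X) / 2 = w / 2 * X + (c + w / 2) := fun X => by ring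
  simp only [e]
  rw [h, smul_eq_mul, ← mul_assoc, mul_inv_cancel₀ (half_pos hw0).ne', one_mul]
  congr 1 <;> ring

/-- A finite family of arcs of the circle with disjoint interiors and total length `1`. -/
structure StripTiling (ι : Type) [Fintype ι] where
  (c w : ι → ℝ)
  w_pos : ∀ i, 0 < w i
  w_lt_one : ∀ i, w i < 1
  sum_w : ∑ i, w i = 1
  disj : ∀ {i k : ι}, i ≠ k → ∀ {u v : ℝ}, u ∈ Icc 0 (w i) → v ∈ Ioo 0 (w k) → ∀ r : ℤ,
    c i + u ≠ c k + v + r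

theorem disjoint_openArc {c w c' w' : ℝ}
    (h : ∀ {u v : ℝ}, u ∈ Icc 0 w → v ∈ Ioo 0 w' → ∀ r : ℤ, c + u ≠ c' + v + r) :
    Disjoint (openArc c w) (openArc c' w') := by
  rw [Set.disjoint_left]
  rintro _ ⟨t, ht, rfl⟩ ⟨t', ht', h'⟩
  obtain ⟨n, hn⟩ := unitAddCircle_coe_eq_iff.1 h'.symm
  refine h (u := t - c) (v := t' - c') ⟨by linarith [ht.1], by linarith [ht.2]⟩
    ⟨by linarith [ht'.1], by linarith [ht'.2]⟩ n (by linarith)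

theorem sum_le_one_of_disjoint_openArc {ι : Type} [Fintype ι] {c w : ι → ℝ} (hw0 : ∀ i, 0 < w i)
    (hw : ∀ i, w i ≤ 1) (h : Pairwise fun i k => Disjoint (openArc (c i) (w i)) (openArc (c k) (w k))) :
    ∑ i, w i ≤ 1 := by
  have h1 : volume (⋃ i, openArc (c i) (w i)) = ENNReal.ofReal (∑ i, w i) := by
    rw [measure_iUnion h (fun i => (isOpen_openArc _ _).measurableSet), tsum_fintype,
      ENNReal.ofReal_sum_of_nonneg (fun i _ => (hw0 i).le)]
    exact Finset.sum_congr rfl fun i _ => volume_openArc _ (hw i)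
  have h2 := measure_mono (μ := (volume : Measure (AddCircle (1 : ℝ))))
    (subset_univ (⋃ i, openArc (c i) (w i)))
  rw [h1, AddCircle.measure_univ] at h2
  exact (ENNReal.ofReal_le_ofReal_iff one_pos.le).1 h2

namespace StripTiling

variable {ι : Type} [Fintype ι] (𝒯 : StripTiling ι)

theorem pairwise_disjoint :
    Pairwise fun i k => Disjoint (openArc (𝒯.c i) (𝒯.w i)) (openArc (𝒯.c k) (𝒯.w k)) :=
  fun _ _ hik => disjoint_openArc (𝒯.disj hik)

theorem volume_iUnion_compl : volume (⋃ i, openArc (𝒯.c i) (𝒯.w i))ᶜ = 0 := by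
  have h1 : volume (⋃ i, openArc (𝒯.c i) (𝒯.w i)) = 1 := by
    rw [measure_iUnion 𝒯.pairwise_disjoint (fun i => (isOpen_openArc _ _).measurableSet),
      tsum_fintype]
    refine Eq.trans ?_ ((congrArg ENNReal.ofReal 𝒯.sum_w).trans ENNReal.ofReal_one)
    rw [ENNReal.ofReal_sum_of_nonneg (fun i _ => (𝒯.w_pos i).le)]
    exact Finset.sum_congr rfl fun i _ => volume_openArc _ (𝒯.w_lt_one i).le
  rw [measure_compl (MeasurableSet.iUnion fun i => (isOpen_openArc _ _).measurableSet)
    (measure_ne_top _ _), h1, AddCircle.measure_univ]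
  simp

/-- The affine parametrization of the `i`-th arc by `[-1, 1]`. -/
def param (i : ι) (X : Icc (-1 : ℝ) 1) : AddCircle (1 : ℝ) :=
  ((𝒯.c i + 𝒯.w i * (1 + X) / 2 : ℝ) : AddCircle (1 : ℝ))

theorem continuous_param (i : ι) : Continuous (𝒯.param i) :=
  (AddCircle.continuous_mk' 1).comp (by fun_prop)

theorem exists_param_eq (x : AddCircle (1 : ℝ)) : ∃ i X, 𝒯.param i X = x := by
  have hc : IsClosed (⋃ i, range (𝒯.param i)) :=
    isClosed_iUnion_of_finite fun i => (isCompact_range (𝒯.continuous_param i)).isClosed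
  have hsub : ⋃ i, openArc (𝒯.c i) (𝒯.w i) ⊆ ⋃ i, range (𝒯.param i) := by
    refine iUnion_mono fun i => ?_
    rintro _ ⟨t, ht, rfl⟩
    have hw := 𝒯.w_pos i
    refine ⟨⟨2 * (t - 𝒯.c i) / 𝒯.w i - 1, ?_, ?_⟩, ?_⟩
    · have : 0 ≤ 2 * (t - 𝒯.c i) / 𝒯.w i := div_nonneg (by linarith [ht.1]) hw.le
      linarith
    · have : 2 * (t - 𝒯.c i) / 𝒯.w i ≤ 2 := (div_le_iff₀ hw).2 (by linarith [ht.2])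
      linarith
    · simp only [param]
      congr 1
      field_simp
      ring
  have h0 : volume (⋃ i, range (𝒯.param i))ᶜ = 0 :=
    measure_mono_null (compl_subset_compl.2 hsub) 𝒯.volume_iUnion_compl
  have he := hc.isOpen_compl.eq_empty_of_measure_zero h0
  have : x ∈ ⋃ i, range (𝒯.param i) := by
    rw [compl_empty_iff] at he
    rw [he]; trivial
  simpa using this

theorem param_eq_param {i k : ι} {X X' : Icc (-1 : ℝ) 1} (h : 𝒯.param i X = 𝒯.param k X') :
    (i = k ∧ X = X') ∨ (|(X : ℝ)| = 1 ∧ |(X' : ℝ)| = 1) := by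
  obtain ⟨n, hn⟩ := unitAddCircle_coe_eq_iff.1 h
  have key : ∀ {j : ι} (Z : Icc (-1 : ℝ) 1), 𝒯.w j * (1 + Z) / 2 ∈ Icc 0 (𝒯.w j) := by
    intro j Z
    have := 𝒯.w_pos j
    have h1 := Z.2.1
    have h2 := Z.2.2
    constructor <;> nlinarith
  have key' : ∀ {j : ι} (Z : Icc (-1 : ℝ) 1), |(Z : ℝ)| ≠ 1 →
      𝒯.w j * (1 + Z) / 2 ∈ Ioo 0 (𝒯.w j) := by
    intro j Z hZ
    have := 𝒯.w_pos j
    have h3 : |(Z : ℝ)| < 1 := lt_of_le_of_ne (abs_le.2 Z.2) hZ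
    rw [abs_lt] at h3
    constructor <;> nlinarith
  by_cases hik : i = k
  · subst hik
    left
    refine ⟨rfl, Subtype.ext ?_⟩
    have h1 := key (j := i) X
    have h2 := key (j := i) X'
    have h3 := 𝒯.w_lt_one i
    have h4 : (n : ℝ) < 1 := by linarith [h1.2, h2.1]
    have h5 : (-1 : ℝ) < n := by linarith [h1.1, h2.2]
    have h6 : n = 0 := by norm_cast at h4 h5; omega
    rw [h6] at hn
    have := 𝒯.w_pos i
    push_cast at hn
    have h7 : 𝒯.w i * (X : ℝ) = 𝒯.w i * (X' : ℝ) := by linarith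
    exact mul_left_cancel₀ this.ne' h7
  · right
    by_contra hcon
    rw [not_and_or] at hcon
    rcases hcon with hc | hc
    · exact 𝒯.disj (Ne.symm hik) (key X') (key' X hc) (-n) (by push_cast; linarith)
    · exact 𝒯.disj hik (key X) (key' X' hc) n hn

theorem integral_eq_sum {g : AddCircle (1 : ℝ) → ℝ} (hg : Continuous g) :
    ∫ x, g x = ∑ i, 𝒯.w i / 2 * ∫ X, g (𝒯.param i X) := by
  have hi : Integrable g := hg.integrable_of_hasCompactSupport (HasCompactSupport.of_compactSpace g)
  have hU : MeasurableSet (⋃ i, openArc (𝒯.c i) (𝒯.w i)) :=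
    MeasurableSet.iUnion fun i => (isOpen_openArc _ _).measurableSet
  rw [← integral_add_compl hU hi, setIntegral_measure_zero _ 𝒯.volume_iUnion_compl, add_zero,
    integral_iUnion_fintype (fun i => (isOpen_openArc _ _).measurableSet) 𝒯.pairwise_disjoint
      (fun i => hi.integrableOn)]
  exact Finset.sum_congr rfl fun i _ =>
    setIntegral_openArc (𝒯.c i) (𝒯.w_pos i) (𝒯.w_lt_one i).le g

end StripTiling

/-- The two-tower tiling of the circle associated with a best approximation. -/
def BestApprox.tiling {α : ℝ} (B : BestApprox α) (hα : Irrational α) :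
    StripTiling (Fin B.q ⊕ Fin B.q') where
  c := B.left
  w := B.width
  w_pos := by
    rintro (i | i)
    · exact B.b_pos
    · exact B.a_pos
  w_lt_one := by
    have h1 := B.add_le_one hα
    have h2 := B.a_pos
    have h3 := B.b_pos
    rintro (i | i) <;> simp only [BestApprox.width, Sum.elim_inl, Sum.elim_inr] <;> linarith
  sum_w := by
    have h1 := B.add_le_one hα
    have h2 := B.a_pos
    have h3 := B.b_pos
    have hpos : ∀ i, 0 < B.width i := by
      rintro (i | i)
      · exact B.b_pos
      · exact B.a_pos
    have hle : ∑ i, B.width i ≤ 1 := by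
      refine sum_le_one_of_disjoint_openArc (c := B.left) hpos ?_ fun i k hik =>
        disjoint_openArc (B.left_add_ne hα hik)
      rintro (i | i) <;> simp only [BestApprox.width, Sum.elim_inl, Sum.elim_inr] <;> linarith
    have h0 : 0 < ∑ i, B.width i :=
      Finset.sum_pos (fun i _ => hpos i) ⟨Sum.inl ⟨0, B.q_pos⟩, Finset.mem_univ _⟩
    rw [B.sum_width_eq_int] at *
    norm_cast at *
    omega
  disj := B.left_add_ne hα

/-- A slowly varying profile on the levels of a tower of height `n`: it vanishes at both ends
and equals `1` away from them. -/
def ramp (δ : ℝ) (n : ℕ) (j : ℝ) : ℝ := min 1 (δ * min j (n - 1 - j))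

theorem ramp_zero {δ : ℝ} {n : ℕ} (hn : 1 ≤ n) : ramp δ n 0 = 0 := by
  have : (1 : ℝ) ≤ n := by exact_mod_cast hn
  rw [ramp, min_eq_left (by linarith : (0 : ℝ) ≤ n - 1 - 0), mul_zero, min_eq_right zero_le_one]

theorem ramp_top {δ : ℝ} {n : ℕ} {j : ℝ} (h : j + 1 = n) (hj : 0 ≤ j) : ramp δ n j = 0 := by
  rw [ramp, min_eq_right (by linarith : (n : ℝ) - 1 - j ≤ j), ← h, add_sub_cancel_right, sub_self,
    mul_zero, min_eq_right zero_le_one]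

theorem abs_ramp_sub_le {δ : ℝ} (hδ : 0 < δ) (n : ℕ) (j : ℝ) :
    |ramp δ n (j + 1) - ramp δ n j| ≤ δ := by
  have h1 : |min (j + 1) (n - 1 - (j + 1)) - min j ((n : ℝ) - 1 - j)| ≤ 1 := by
    refine (abs_min_sub_min_le_max _ _ _ _).trans (max_le ?_ ?_) <;> rw [abs_le] <;>
      constructor <;> linarith
  refine (abs_min_sub_min_le_max _ _ _ _).trans (max_le (by simpa using hδ.le) ?_)
  rw [← mul_sub, abs_mul, abs_of_pos hδ]
  nlinarith

theorem card_ramp_ne_one_le {δ : ℝ} (hδ : 0 < δ) (n : ℕ) :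
    (Finset.univ.filter fun j : Fin n => ramp δ n j ≠ 1).card ≤ 2 * ⌈1 / δ⌉₊ := by
  classical
  set K := ⌈1 / δ⌉₊
  have hK : 1 ≤ δ * K := by
    have := Nat.le_ceil (1 / δ)
    rw [div_le_iff₀ hδ] at this
    linarith
  have hsub : (Finset.univ.filter fun j : Fin n => ramp δ n j ≠ 1) ⊆
      (Finset.univ.filter fun j : Fin n => (j : ℕ) < K) ∪
      (Finset.univ.filter fun j : Fin n => n - 1 - (j : ℕ) < K) := by
    intro j hj
    simp only [Finset.mem_filter, Finset.mem_univ, true_and, Finset.mem_union] at hj ⊢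
    by_contra! hcon
    refine hj (min_eq_left (hK.trans (mul_le_mul_of_nonneg_left (le_min ?_ ?_) hδ.le)))
    · exact_mod_cast hcon.1
    · have hj2 := j.2
      have h2 := hcon.2
      have : K + 1 + (j : ℕ) ≤ n := by omega
      have : (K : ℝ) + 1 + (j : ℕ) ≤ n := by exact_mod_cast this
      linarith
  refine (Finset.card_le_card hsub).trans ((Finset.card_union_le _ _).trans ?_)
  have h1 : (Finset.univ.filter fun j : Fin n => (j : ℕ) < K).card ≤ (Finset.range K).card :=
    Finset.card_le_card_of_injOn (fun j => (j : ℕ)) (fun j hj => by simpa using hj)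
      (fun j _ k _ h => Fin.ext h)
  have h2 : (Finset.univ.filter fun j : Fin n => n - 1 - (j : ℕ) < K).card ≤
      (Finset.range K).card :=
    Finset.card_le_card_of_injOn (fun j => n - 1 - (j : ℕ)) (fun j hj => by simpa using hj)
      (fun j _ k _ h => Fin.ext (by simp only at h; omega))
  rw [Finset.card_range] at h1 h2
  omega

/-- A tiling of the circle by short arcs together with a slowly varying profile `s` along the
rotation by `α`, equal to `1` on most arcs and `0` wherever the rotation does not map arcs of the
tiling to arcs of the tiling. -/
structure RampedTiling (α δ ε : ℝ) (ι : Type) [Fintype ι] extends StripTiling ι where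
  s : ι → ℝ
  w_lt : ∀ i, w i < ε
  succ : ∀ i, s i = 0 ∨ ∃ k, c k = c i + α ∧ w k = w i ∧ |s k - s i| ≤ δ
  pred : ∀ k, s k = 0 ∨ ∃ i, c k = c i + α ∧ w k = w i ∧ |s k - s i| ≤ δ
  sum_bad : ∑ i, (if s i = 1 then 0 else w i) ≤ ε

theorem exists_rampedTiling {α : ℝ} (hα : Irrational α) {δ ε : ℝ} (hδ : 0 < δ) (hε : 0 < ε) :
    ∃ (ι : Type) (_ : Fintype ι), Nonempty (RampedTiling α δ ε ι) := by
  set K := ⌈1 / δ⌉₊ with hKdef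
  have hK : (0 : ℝ) ≤ K := Nat.cast_nonneg K
  obtain ⟨B, ha, hb⟩ := exists_bestApprox hα (ε := ε / (4 * K + 1)) (by positivity)
  have hε' : ε / (4 * K + 1) ≤ ε := div_le_self hε.le (by linarith)
  rw [lt_div_iff₀ (by positivity)] at ha hb
  have ha0 := B.a_pos
  have hb0 := B.b_pos
  have hsum : ∀ (n : ℕ) {x : ℝ}, 0 ≤ x →
      ∑ j : Fin n, (if ramp δ n j = 1 then 0 else x) ≤ 2 * K * x := by
    intro n x hx
    have h := card_ramp_ne_one_le hδ n
    have h' : ((Finset.univ.filter fun j : Fin n => ramp δ n j ≠ 1).card : ℝ) ≤ 2 * K := by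
      exact_mod_cast h
    rw [← Finset.sum_filter_add_sum_filter_not Finset.univ (fun j : Fin n => ramp δ n j = 1)]
    rw [Finset.sum_eq_zero (fun j hj => if_pos (Finset.mem_filter.1 hj).2), zero_add,
      Finset.sum_congr rfl (fun j hj => if_neg (Finset.mem_filter.1 hj).2), Finset.sum_const,
      nsmul_eq_mul]
    exact mul_le_mul_of_nonneg_right h' hx
  refine ⟨_, inferInstance, ⟨{ B.tiling hα with
    s := Sum.elim (fun j => ramp δ B.q j) (fun j => ramp δ B.q' j)
    w_lt := ?_
    succ := ?_
    pred := ?_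
    sum_bad := ?_ }⟩⟩
  · rintro (i | i) <;> simp only [BestApprox.tiling, BestApprox.width, Sum.elim_inl, Sum.elim_inr] <;>
      nlinarith
  · rintro (⟨j, hj⟩ | ⟨j, hj⟩)
    · by_cases h : j + 1 < B.q
      · right
        refine ⟨Sum.inl ⟨j + 1, h⟩, ?_, rfl, ?_⟩
        · simp only [BestApprox.tiling, BestApprox.left, Sum.elim_inl]; push_cast; ring
        · simpa using abs_ramp_sub_le hδ B.q (j : ℝ)
      · left
        exact ramp_top (by exact_mod_cast (by omega : j + 1 = B.q)) (Nat.cast_nonneg _)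
    · by_cases h : j + 1 < B.q'
      · right
        refine ⟨Sum.inr ⟨j + 1, h⟩, ?_, rfl, ?_⟩
        · simp only [BestApprox.tiling, BestApprox.left, Sum.elim_inr]; push_cast; ring
        · simpa using abs_ramp_sub_le hδ B.q' (j : ℝ)
      · left
        exact ramp_top (by exact_mod_cast (by omega : j + 1 = B.q')) (Nat.cast_nonneg _)
  · rintro (⟨j, hj⟩ | ⟨j, hj⟩)
    · rcases j with _ | j
      · left
        simpa using ramp_zero B.q_pos
      · right
        refine ⟨Sum.inl ⟨j, by omega⟩, ?_, rfl, ?_⟩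
        · simp only [BestApprox.tiling, BestApprox.left, Sum.elim_inl]; push_cast; ring
        · simpa using abs_ramp_sub_le hδ B.q (j : ℝ)
    · rcases j with _ | j
      · left
        simpa using ramp_zero B.q'_pos
      · right
        refine ⟨Sum.inr ⟨j, by omega⟩, ?_, rfl, ?_⟩
        · simp only [BestApprox.tiling, BestApprox.left, Sum.elim_inr]; push_cast; ring
        · simpa using abs_ramp_sub_le hδ B.q' (j : ℝ)
  · rw [Fintype.sum_sum_type]
    refine (add_le_add (hsum B.q hb0.le) (hsum B.q' ha0.le)).trans ?_
    nlinarith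

/-- A continuous function on a compact space that is constant on the fibres of a continuous
surjection onto a Hausdorff space descends to a continuous function. -/
theorem exists_continuousMap_comp_eq {X Y Z : Type*} [TopologicalSpace X] [TopologicalSpace Y]
    [TopologicalSpace Z] [CompactSpace X] [T2Space Y] {Φ : X → Y} (hΦ : Continuous Φ)
    (hsurj : Function.Surjective Φ) {g : X → Z} (hg : Continuous g)
    (h : ∀ a b, Φ a = Φ b → g a = g b) : ∃ G : C(Y, Z), ∀ a, G (Φ a) = g a := by
  have hq := Topology.IsQuotientMap.of_surjective_continuous hsurj hΦ
  refine ⟨⟨fun y => g (Function.surjInv hsurj y), ?_⟩, fun a => ?_⟩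
  · rw [hq.continuous_iff]
    convert hg using 1
    exact funext fun a => h _ _ (Function.surjInv_eq hsurj _)
  · exact h _ _ (Function.surjInv_eq hsurj _)

/-- The square `[-1,1]²`. -/
abbrev Square := Icc (-1 : ℝ) 1 × Icc (-1 : ℝ) 1

/-- The first coordinate of the constant-speed parametrization of the boundary of `[-1,1]²`. -/
def squareCos (θ : AddCircle (1 : ℝ)) : ℝ := max (-1) (min 1 (2 - 8 * ‖θ‖))

/-- The second coordinate of the constant-speed parametrization of the boundary of `[-1,1]²`. -/
def squareSin (θ : AddCircle (1 : ℝ)) : ℝ := squareCos (θ - ((1 / 4 : ℝ) : AddCircle (1 : ℝ)))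

theorem continuous_squareCos : Continuous squareCos := by unfold squareCos; fun_prop

theorem continuous_squareSin : Continuous squareSin :=
  continuous_squareCos.comp (continuous_id.sub continuous_const)

theorem squareCos_mem (θ : AddCircle (1 : ℝ)) : squareCos θ ∈ Icc (-1 : ℝ) 1 :=
  ⟨le_max_left _ _, max_le (by norm_num) (min_le_left _ _)⟩

theorem norm_coe_of_abs_le {t : ℝ} (ht : |t| ≤ 1 / 2) : ‖(t : AddCircle (1 : ℝ))‖ = |t| := by
  rw [AddCircle.norm_coe_eq_abs_iff 1 one_ne_zero]
  simpa using ht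

theorem squareCos_coe {t : ℝ} (ht : |t| ≤ 1 / 2) :
    squareCos (t : AddCircle (1 : ℝ)) = max (-1) (min 1 (2 - 8 * |t|)) := by
  rw [squareCos, norm_coe_of_abs_le ht]

theorem exists_coe_eq_Ico (a : ℝ) (θ : AddCircle (1 : ℝ)) :
    ∃ x : ℝ, a ≤ x ∧ x < a + 1 ∧ (x : AddCircle (1 : ℝ)) = θ := by
  have := AddCircle.coe_image_Ico_eq (1 : ℝ) a
  obtain ⟨x, hx, h⟩ := this.symm.subset (mem_univ θ)
  exact ⟨x, hx.1, hx.2, h⟩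

theorem coe_add_one (x : ℝ) : ((x + 1 : ℝ) : AddCircle (1 : ℝ)) = x :=
  unitAddCircle_coe_eq_iff.2 ⟨1, by simp⟩

theorem squareCos_add_half (θ : AddCircle (1 : ℝ)) :
    squareCos (θ + ((1 / 2 : ℝ) : AddCircle (1 : ℝ))) = -squareCos θ := by
  obtain ⟨x, h1, h2, rfl⟩ := exists_coe_eq_Ico (-1 / 2) θ
  have hx : |x| ≤ 1 / 2 := by rw [abs_le]; constructor <;> linarith
  rw [squareCos_coe hx]
  rcases le_total 0 x with h | h
  · have : ((x : AddCircle (1 : ℝ)) + ((1 / 2 : ℝ) : AddCircle (1 : ℝ))) = ((x - 1 / 2 : ℝ) : AddCircle (1 : ℝ)) := by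
      rw [← coe_add_one (x - 1 / 2), ← AddCircle.coe_add]; congr 1; ring
    rw [this, squareCos_coe (by rw [abs_le]; constructor <;> linarith), abs_of_nonneg h,
      abs_of_nonpos (by linarith)]
    rcases le_total (1 / 8) x with h3 | h3
    · rcases le_total (3 / 8) x with h4 | h4
      · rw [min_eq_left (by linarith), min_eq_right (by linarith), max_eq_right (by linarith),
          max_eq_left (by linarith)]; norm_num
      · rw [min_eq_right (by linarith), min_eq_right (by linarith), max_eq_right (by linarith),
          max_eq_right (by linarith)]; ring
    · rw [min_eq_right (by linarith), min_eq_left (by linarith), max_eq_left (by linarith),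
          max_eq_right (by linarith)]
  · rw [← AddCircle.coe_add, squareCos_coe (by rw [abs_le]; constructor <;> linarith),
      abs_of_nonpos h, abs_of_nonneg (by linarith)]
    rcases le_total x (-1 / 8) with h3 | h3
    · rcases le_total x (-3 / 8) with h4 | h4
      · rw [min_eq_left (by linarith), min_eq_right (by linarith), max_eq_right (by linarith),
          max_eq_left (by linarith)]; norm_num
      · rw [min_eq_right (by linarith), min_eq_right (by linarith), max_eq_right (by linarith),
          max_eq_right (by linarith)]; ring
    · rw [min_eq_right (by linarith), min_eq_left (by linarith), max_eq_left (by linarith),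
          max_eq_right (by linarith)]

theorem squareCos_add_quarter (θ : AddCircle (1 : ℝ)) :
    squareCos (θ + ((1 / 4 : ℝ) : AddCircle (1 : ℝ))) = -squareSin θ := by
  rw [squareSin, ← squareCos_add_half]
  congr 1
  rw [sub_add_eq_add_sub, eq_sub_iff_add_eq, add_assoc, ← AddCircle.coe_add]
  norm_num

theorem squareSin_add_quarter (θ : AddCircle (1 : ℝ)) :
    squareSin (θ + ((1 / 4 : ℝ) : AddCircle (1 : ℝ))) = squareCos θ := by
  rw [squareSin, add_sub_cancel_right]

theorem squareCos_of_abs_le {t : ℝ} (ht : |t| ≤ 1 / 8) : squareCos (t : AddCircle (1 : ℝ)) = 1 := by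
  rw [squareCos_coe (by linarith), min_eq_left (by linarith), max_eq_right (by norm_num)]

theorem squareSin_of_abs_le {t : ℝ} (ht : |t| ≤ 1 / 8) :
    squareSin (t : AddCircle (1 : ℝ)) = 8 * t := by
  rw [abs_le] at ht
  rw [squareSin, ← AddCircle.coe_sub, squareCos_coe (by rw [abs_le]; constructor <;> linarith),
    abs_of_nonpos (by linarith), min_eq_right (by linarith), max_eq_right (by linarith)]
  ring

theorem exists_eq_of_squareCos_eq_one {θ : AddCircle (1 : ℝ)} (h : squareCos θ = 1) :
    ∃ t : ℝ, |t| ≤ 1 / 8 ∧ θ = t := by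
  obtain ⟨x, h1, h2, rfl⟩ := exists_coe_eq_Ico (-1 / 2) θ
  have hx : |x| ≤ 1 / 2 := by rw [abs_le]; constructor <;> linarith
  refine ⟨x, ?_, rfl⟩
  rw [squareCos_coe hx] at h
  by_contra! hcon
  have : max (-1) (min 1 (2 - 8 * |x|)) < 1 := max_lt (by norm_num) (min_lt_of_right_lt (by linarith))
  linarith

/-- Induction principle reducing a property of angles to the side `[-1/8, 1/8]`. -/
theorem angle_induction {p : AddCircle (1 : ℝ) → Prop} (h0 : ∀ t : ℝ, |t| ≤ 1 / 8 → p t)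
    (h1 : ∀ θ, p θ → p (θ + ((1 / 4 : ℝ) : AddCircle (1 : ℝ)))) (θ : AddCircle (1 : ℝ)) : p θ := by
  obtain ⟨x, hx1, hx2, rfl⟩ := exists_coe_eq_Ico (-1 / 8) θ
  have key : ∀ (n : ℕ) (x : ℝ), |x - n / 4| ≤ 1 / 8 → p x := by
    intro n
    induction n with
    | zero => intro x hx; exact h0 x (by simpa using hx)
    | succ n ih =>
      intro x hx
      have := h1 _ (ih (x - 1 / 4) (le_of_eq_of_le (by push_cast; congr 1; ring) hx))
      rwa [← AddCircle.coe_add, sub_add_cancel] at this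
  rcases le_total x (1 / 8) with h | h
  · exact h0 x (by rw [abs_le]; constructor <;> linarith)
  rcases le_total x (3 / 8) with h' | h'
  · exact key 1 x (by rw [abs_le]; push_cast; constructor <;> linarith)
  rcases le_total x (5 / 8) with h'' | h''
  · exact key 2 x (by rw [abs_le]; push_cast; constructor <;> linarith)
  · exact key 3 x (by rw [abs_le]; push_cast; constructor <;> linarith)

theorem squareCos_squareSin_injective {θ θ' : AddCircle (1 : ℝ)} (hc : squareCos θ = squareCos θ')
    (hs : squareSin θ = squareSin θ') : θ = θ' := by
  induction θ using angle_induction generalizing θ' with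
  | h0 t ht =>
    rw [squareCos_of_abs_le ht] at hc
    obtain ⟨t', ht', rfl⟩ := exists_eq_of_squareCos_eq_one hc.symm
    rw [squareSin_of_abs_le ht, squareSin_of_abs_le ht'] at hs
    congr 1; linarith
  | h1 θ ih =>
    rw [← sub_add_cancel θ' ((1 / 4 : ℝ) : AddCircle (1 : ℝ))] at hc hs ⊢
    rw [squareCos_add_quarter, squareCos_add_quarter] at hc
    rw [squareSin_add_quarter, squareSin_add_quarter] at hs
    rw [ih hs (by linarith)]

theorem max_abs_squareCos_squareSin (θ : AddCircle (1 : ℝ)) :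
    max |squareCos θ| |squareSin θ| = 1 := by
  induction θ using angle_induction with
  | h0 t ht =>
    rw [squareCos_of_abs_le ht, squareSin_of_abs_le ht, abs_one, max_eq_left]
    rw [abs_mul, abs_of_pos (by norm_num : (0 : ℝ) < 8)]
    linarith
  | h1 θ h =>
    rw [squareCos_add_quarter, squareSin_add_quarter, abs_neg, max_comm, h]

/-- Polar coordinates on the square adapted to the sup norm. -/
def squarePolar (z : Icc (0 : ℝ) 1 × AddCircle (1 : ℝ)) : Square :=
  (⟨z.1 * squareCos z.2, by
      have h1 := z.1.2.1; have h2 := z.1.2.2; have h3 := squareCos_mem z.2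
      constructor <;> nlinarith [h3.1, h3.2]⟩,
    ⟨z.1 * squareSin z.2, by
      have h1 := z.1.2.1; have h2 := z.1.2.2
      have h3 := squareCos_mem (z.2 - ((1 / 4 : ℝ) : AddCircle (1 : ℝ)))
      rw [squareSin]
      constructor <;> nlinarith [h3.1, h3.2]⟩)

theorem continuous_squarePolar : Continuous squarePolar := by
  have := continuous_squareCos
  have := continuous_squareSin
  unfold squarePolar
  fun_prop

/-- The sup norm on the square. -/
def squareRadius (q : Square) : Icc (0 : ℝ) 1 :=
  ⟨max |(q.1 : ℝ)| |(q.2 : ℝ)|, le_max_of_le_left (abs_nonneg _),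
    max_le (abs_le.2 q.1.2) (abs_le.2 q.2.2)⟩

theorem continuous_squareRadius : Continuous squareRadius := by
  unfold squareRadius
  fun_prop

theorem squareRadius_squarePolar (z : Icc (0 : ℝ) 1 × AddCircle (1 : ℝ)) :
    squareRadius (squarePolar z) = z.1 := by
  apply Subtype.ext
  simp only [squareRadius, squarePolar, abs_mul, abs_of_nonneg z.1.2.1]
  rw [← mul_max_of_nonneg _ _ z.1.2.1, max_abs_squareCos_squareSin, mul_one]

theorem eq_of_squarePolar_eq {z z' : Icc (0 : ℝ) 1 × AddCircle (1 : ℝ)}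
    (h : squarePolar z = squarePolar z') : z.1 = z'.1 ∧ ((z.1 : ℝ) = 0 ∨ z.2 = z'.2) := by
  have hr : z.1 = z'.1 := by rw [← squareRadius_squarePolar z, h, squareRadius_squarePolar]
  refine ⟨hr, or_iff_not_imp_left.2 fun h0 => ?_⟩
  have h1 := congrArg (fun q : Square => (q.1 : ℝ)) h
  have h2 := congrArg (fun q : Square => (q.2 : ℝ)) h
  simp only [squarePolar, ← hr] at h1 h2
  exact squareCos_squareSin_injective (mul_left_cancel₀ h0 h1) (mul_left_cancel₀ h0 h2)

/-- Rotation by a right angle. -/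
def quarterTurn (q : Square) : Square :=
  (⟨-q.2, by linarith [q.2.2.2], by linarith [q.2.2.1]⟩, q.1)

theorem quarterTurn_squarePolar (r : Icc (0 : ℝ) 1) (θ : AddCircle (1 : ℝ)) :
    squarePolar (r, θ + ((1 / 4 : ℝ) : AddCircle (1 : ℝ))) = quarterTurn (squarePolar (r, θ)) := by
  refine Prod.ext (Subtype.ext ?_) (Subtype.ext ?_)
  · simp only [squarePolar, quarterTurn, squareCos_add_quarter, mul_neg]
  · simp only [squarePolar, quarterTurn, squareSin_add_quarter]

theorem quarterTurn_iterate_four (q : Square) :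
    quarterTurn (quarterTurn (quarterTurn (quarterTurn q))) = q := by
  refine Prod.ext (Subtype.ext ?_) (Subtype.ext ?_) <;> simp [quarterTurn]

theorem surjective_squarePolar : Function.Surjective squarePolar := by
  have h0 : ∀ q : Square, |(q.2 : ℝ)| ≤ q.1 → q ∈ range squarePolar := by
    intro q hq
    have h1 := (abs_nonneg _).trans hq
    refine ⟨(⟨q.1, h1, q.1.2.2⟩, ((q.2 / (8 * q.1) : ℝ) : AddCircle (1 : ℝ))), ?_⟩
    have ht : |(q.2 / (8 * q.1) : ℝ)| ≤ 1 / 8 := by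
      rw [abs_div, abs_mul, abs_of_nonneg h1, abs_of_pos (by norm_num : (0 : ℝ) < 8)]
      refine div_le_of_le_mul₀ (by positivity) (by norm_num) (by linarith)
    refine Prod.ext (Subtype.ext ?_) (Subtype.ext ?_)
    · simp only [squarePolar, squareCos_of_abs_le ht, mul_one]
    · simp only [squarePolar, squareSin_of_abs_le ht]
      rcases h1.eq_or_lt with h | h
      · rw [← h] at hq ⊢
        rw [abs_nonpos_iff.1 hq, zero_mul]
      · field_simp
  have h1 : ∀ q : Square, quarterTurn q ∈ range squarePolar → q ∈ range squarePolar := by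
    rintro q ⟨⟨r, θ⟩, h⟩
    rw [← quarterTurn_iterate_four q, ← h, ← quarterTurn_squarePolar, ← quarterTurn_squarePolar,
      ← quarterTurn_squarePolar]
    exact mem_range_self _
  intro q
  rcases le_total |(q.2 : ℝ)| |(q.1 : ℝ)| with h | h
  · rcases le_total 0 (q.1 : ℝ) with h' | h'
    · exact h0 q (by rwa [abs_of_nonneg h'] at h)
    · refine h1 _ (h1 _ (h0 _ ?_))
      rw [abs_of_nonpos h'] at h
      simpa [quarterTurn] using h
  · rcases le_total 0 (q.2 : ℝ) with h' | h'
    · refine h1 _ (h1 _ (h1 _ (h0 _ ?_)))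
      rw [abs_of_nonneg h'] at h
      simpa [quarterTurn] using h
    · refine h1 _ (h0 _ ?_)
      rw [abs_of_nonpos h'] at h
      simpa [quarterTurn] using h

theorem exists_squareRotation : ∃ ρ : C(AddCircle (1 : ℝ) × Square, Square),
    ∀ ψ r θ, ρ (ψ, squarePolar (r, θ)) = squarePolar (r, θ + ψ) := by
  have hc := continuous_squarePolar
  obtain ⟨ρ, hρ⟩ := exists_continuousMap_comp_eq
    (X := AddCircle (1 : ℝ) × Icc (0 : ℝ) 1 × AddCircle (1 : ℝ))
    (Φ := fun z => (z.1, squarePolar z.2)) (by fun_prop)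
    (fun ⟨ψ, q⟩ => by
      obtain ⟨z, rfl⟩ := surjective_squarePolar q
      exact ⟨(ψ, z), rfl⟩)
    (g := fun z => squarePolar (z.2.1, z.2.2 + z.1)) (by fun_prop) (by
      rintro ⟨ψ, r, θ⟩ ⟨ψ', r', θ'⟩ h
      obtain ⟨h1, h2⟩ := Prod.mk.inj h
      obtain ⟨h3, h4⟩ := eq_of_squarePolar_eq h2
      simp only at h1 h3 h4 ⊢
      subst h1 h3
      rcases h4 with h4 | rfl
      · simp [squarePolar, h4]
      · rfl)
  exact ⟨ρ, fun ψ r θ => hρ (ψ, r, θ)⟩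

/-- Rotation of the square in the polar coordinates `squarePolar`. -/
def squareRotation : C(AddCircle (1 : ℝ) × Square, Square) := exists_squareRotation.choose

theorem squareRotation_squarePolar (ψ : AddCircle (1 : ℝ)) (r : Icc (0 : ℝ) 1)
    (θ : AddCircle (1 : ℝ)) :
    squareRotation (ψ, squarePolar (r, θ)) = squarePolar (r, θ + ψ) :=
  exists_squareRotation.choose_spec ψ r θ

/-- The twist flow on the square: sup-norm circles rotate with speed `1/4` inside the
square of half-side `1 - η`, slowing down to `0` at the boundary. -/
def squareTwist (η : ℝ) : C(ℝ × Square, Square) where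
  toFun z := squareRotation
    (((z.1 * (min 1 ((1 - squareRadius z.2) / η) / 4) : ℝ) : AddCircle (1 : ℝ)), z.2)
  continuous_toFun := by
    have := continuous_squareRadius
    have := AddCircle.continuous_mk' (1 : ℝ)
    refine squareRotation.continuous.comp (Continuous.prodMk (this.comp ?_) continuous_snd)
    fun_prop

section Twist

variable {η : ℝ}

theorem squareTwist_squarePolar (s : ℝ) (r : Icc (0 : ℝ) 1) (θ : AddCircle (1 : ℝ)) :
    squareTwist η (s, squarePolar (r, θ)) =
      squarePolar (r, θ + ((s * (min 1 ((1 - r) / η) / 4) : ℝ) : AddCircle (1 : ℝ))) := by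
  simp only [squareTwist, ContinuousMap.coe_mk, squareRadius_squarePolar,
    squareRotation_squarePolar]

theorem squareTwist_zero (q : Square) : squareTwist η (0, q) = q := by
  obtain ⟨⟨r, θ⟩, rfl⟩ := surjective_squarePolar q
  simp [squareTwist_squarePolar]

theorem squareTwist_add (s t : ℝ) (q : Square) :
    squareTwist η (s + t, q) = squareTwist η (s, squareTwist η (t, q)) := by
  obtain ⟨⟨r, θ⟩, rfl⟩ := surjective_squarePolar q
  rw [squareTwist_squarePolar, squareTwist_squarePolar, squareTwist_squarePolar, add_assoc,
    ← AddCircle.coe_add, add_mul, add_comm (s * _)]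

theorem squareTwist_of_radius_eq_one (s : ℝ) {q : Square} (hq : (squareRadius q : ℝ) = 1) :
    squareTwist η (s, q) = q := by
  obtain ⟨⟨r, θ⟩, rfl⟩ := surjective_squarePolar q
  rw [squareRadius_squarePolar] at hq
  replace hq : (r : ℝ) = 1 := hq
  simp [squareTwist_squarePolar, hq]

theorem squareTwist_one (hη : 0 < η) {q : Square} (hq : (squareRadius q : ℝ) ≤ 1 - η) :
    squareTwist η (1, q) = quarterTurn q := by
  obtain ⟨⟨r, θ⟩, rfl⟩ := surjective_squarePolar q
  rw [squareRadius_squarePolar] at hq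
  rw [squareTwist_squarePolar, min_eq_left, one_mul, quarterTurn_squarePolar]
  rw [one_le_div hη]
  linarith

end Twist

theorem volume_univ_Icc : volume (univ : Set (Icc (-1 : ℝ) 1)) = 2 := by
  rw [Measure.Subtype.volume_univ measurableSet_Icc.nullMeasurableSet, Real.volume_Icc]
  norm_num

instance isFiniteMeasure_volume_Icc : IsFiniteMeasure (volume : Measure (Icc (-1 : ℝ) 1)) :=
  ⟨by rw [volume_univ_Icc]; exact ENNReal.ofNat_lt_top⟩

theorem integral_Icc_symm {g : ℝ → ℝ} (hg : Continuous g) :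
    ∫ x in (-1 : ℝ)..1, g x = ∫ x in (0 : ℝ)..1, (g x + g (-x)) := by
  have h1 := hg.intervalIntegrable (μ := volume)
  rw [← intervalIntegral.integral_add_adjacent_intervals (h1 (-1) 0) (h1 0 1),
    intervalIntegral.integral_add (h1 0 1)
      ((by fun_prop : Continuous fun x => g (-x)).intervalIntegrable 0 1),
    intervalIntegral.integral_comp_neg (fun x => g x)]
  simp [add_comm]

theorem integral_indicator_abs_le (g : ℝ → ℝ) {r : ℝ} (hr : 0 ≤ r) (hr1 : r ≤ 1) :
    ∫ y in (-1 : ℝ)..1, {y | |y| ≤ r}.indicator g y = ∫ y in (-r)..r, g y := by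
  rw [intervalIntegral.integral_of_le (by norm_num), intervalIntegral.integral_of_le (by linarith),
    ← integral_Icc_eq_integral_Ioc, ← integral_Icc_eq_integral_Ioc,
    setIntegral_indicator]
  · congr 2
    ext y
    simp only [mem_inter_iff, mem_Icc, mem_ofPred_eq, abs_le]
    constructor
    · exact fun h => h.2
    · exact fun h => ⟨⟨by linarith [h.1], by linarith [h.2]⟩, h⟩
  · exact measurableSet_le measurable_norm measurable_const

theorem continuous_integral_neg_abs_abs {V : ℝ → ℝ → ℝ}
    (hV : Continuous fun z : ℝ × ℝ => V z.1 z.2) :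
    Continuous fun x => ∫ y in (-|x|)..|x|, V x y := by
  have h : ∀ {s : ℝ → ℝ}, Continuous s → Continuous fun x => ∫ y in (0 : ℝ)..s x, V x y :=
    fun hs => intervalIntegral.continuous_parametric_intervalIntegral_of_continuous hV hs
  have hi : ∀ x a b, IntervalIntegrable (V x) volume a b := fun x a b =>
    (hV.comp (by fun_prop : Continuous fun y => (x, y))).intervalIntegrable a b
  refine ((h continuous_abs).sub (h continuous_abs.neg)).congr fun x => ?_
  exact intervalIntegral.integral_interval_sub_left (hi _ _ _) (hi _ _ _)

/-- Decomposition of the integral over a square into the integrals over the concentric squares. -/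
theorem integral_square_eq {U : ℝ → ℝ → ℝ} (hU : Continuous fun z : ℝ × ℝ => U z.1 z.2) :
    ∫ x in (-1 : ℝ)..1, ∫ y in (-1 : ℝ)..1, U x y =
      ∫ r in (0 : ℝ)..1, ∫ t in (-r)..r, (U r t + U (-r) (-t) + U (-t) r + U t (-r)) := by
  have hI : IntegrableOn (fun z : ℝ × ℝ => U z.1 z.2) (Ioc (-1) 1 ×ˢ Ioc (-1) 1)
      (volume.prod volume) := 
    (hU.continuousOn.integrableOn_compact (isCompact_Icc.prod isCompact_Icc)).mono_set
      (prod_mono Ioc_subset_Icc_self Ioc_subset_Icc_self)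
  set S : Set (ℝ × ℝ) := {z | |z.2| ≤ |z.1|} with hS
  have hSm : MeasurableSet S := measurableSet_le (by fun_prop) (by fun_prop)
  have hx : ∫ z in Ioc (-1 : ℝ) 1 ×ˢ Ioc (-1 : ℝ) 1, S.indicator (fun z : ℝ × ℝ => U z.1 z.2) z
      ∂(volume.prod volume) = ∫ x in (-1 : ℝ)..1, ∫ y in (-|x|)..|x|, U x y := by
    rw [setIntegral_prod _ (hI.indicator hSm), intervalIntegral.integral_of_le (by norm_num)]
    refine setIntegral_congr_fun measurableSet_Ioc fun x hx => ?_
    rw [← integral_indicator_abs_le _ (abs_nonneg x) (abs_le.2 ⟨hx.1.le, hx.2⟩),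
      intervalIntegral.integral_of_le (by norm_num)]
    rfl
  have hy : ∫ z in Ioc (-1 : ℝ) 1 ×ˢ Ioc (-1 : ℝ) 1, Sᶜ.indicator (fun z : ℝ × ℝ => U z.1 z.2) z
      ∂(volume.prod volume) = ∫ y in (-1 : ℝ)..1, ∫ x in (-|y|)..|y|, U x y := by
    rw [← Measure.prod_restrict, integral_prod_symm _ (by
      rw [Measure.prod_restrict]; exact hI.indicator hSm.compl),
      intervalIntegral.integral_of_le (by norm_num)]
    refine setIntegral_congr_fun measurableSet_Ioc fun y hy => ?_
    rw [← integral_indicator_abs_le _ (abs_nonneg y) (abs_le.2 ⟨hy.1.le, hy.2⟩),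
      intervalIntegral.integral_of_le (by norm_num)]
    refine setIntegral_congr_ae measurableSet_Ioc ?_
    have : ∀ᵐ x : ℝ, x ∉ ({|y|, -|y|} : Set ℝ) :=
      compl_mem_ae_iff.2 ((Set.toFinite _).measure_zero _)
    filter_upwards [this] with x hx _
    have hne : |x| ≠ |y| := fun h => hx (by
      rcases abs_choice x with h' | h'
      · left; linarith
      · right; rw [mem_singleton_iff]; linarith)
    by_cases h : |x| ≤ |y|
    · rw [indicator_of_mem (by simpa [hS] using lt_of_le_of_ne h hne),
        indicator_of_mem (by simpa using h)]
    · rw [indicator_of_notMem (by simpa [hS] using (not_le.1 h).le),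
        indicator_of_notMem (by simpa using h)]
  have hsum : ∫ x in (-1 : ℝ)..1, ∫ y in (-1 : ℝ)..1, U x y =
      (∫ x in (-1 : ℝ)..1, ∫ y in (-|x|)..|x|, U x y) +
      ∫ y in (-1 : ℝ)..1, ∫ x in (-|y|)..|y|, U x y := by
    rw [← hx, ← hy, ← integral_add (hI.indicator hSm) (hI.indicator hSm.compl)]
    simp only [indicator_self_add_compl_apply]
    rw [setIntegral_prod _ hI]
    simp only [intervalIntegral.integral_of_le (by norm_num : (-1 : ℝ) ≤ 1)]
  have hU' : Continuous fun z : ℝ × ℝ => U z.2 z.1 := hU.comp continuous_swap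
  have hc1 := continuous_integral_neg_abs_abs hU
  have hc2 := continuous_integral_neg_abs_abs (V := fun x y => U y x) hU'
  rw [hsum, integral_Icc_symm hc1, integral_Icc_symm hc2]
  refine (intervalIntegral.integral_add
    ((hc1.add (hc1.comp continuous_neg)).intervalIntegrable _ _)
    ((hc2.add (hc2.comp continuous_neg)).intervalIntegrable _ _)).symm.trans ?_
  refine intervalIntegral.integral_congr fun r hr => ?_
  rw [uIcc_of_le zero_le_one] at hr
  have e1 : ∫ t in (-r)..r, U (-r) (-t) = ∫ t in (-r)..r, U (-r) t := by
    rw [intervalIntegral.integral_comp_neg (fun t => U (-r) t), neg_neg]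
  have e2 : ∫ t in (-r)..r, U (-t) r = ∫ t in (-r)..r, U t r := by
    rw [intervalIntegral.integral_comp_neg (fun t => U t r), neg_neg]
  have hUc : ∀ {a b : ℝ → ℝ}, Continuous a → Continuous b →
      IntervalIntegrable (fun t => U (a t) (b t)) volume (-r) r := fun ha hb =>
    (hU.comp (ha.prodMk hb)).intervalIntegrable _ _
  have i1 := hUc (a := fun _ => r) (b := fun t => t) (by fun_prop) (by fun_prop)
  have i2 := hUc (a := fun _ => -r) (b := fun t => -t) (by fun_prop) (by fun_prop)
  have i3 := hUc (a := fun t => -t) (b := fun _ => r) (by fun_prop) (by fun_prop)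
  have i4 := hUc (a := fun t => t) (b := fun _ => -r) (by fun_prop) (by fun_prop)
  simp only [Pi.add_apply, Function.comp_apply, abs_neg, abs_of_nonneg hr.1]
  rw [intervalIntegral.integral_add ((i1.add i2).add i3) i4,
    intervalIntegral.integral_add (i1.add i2) i3, intervalIntegral.integral_add i1 i2, e1, e2]
  ring

theorem integral_addCircle_eq_quarters {f : AddCircle (1 : ℝ) → ℝ} (hf : Continuous f) :
    ∫ θ, f θ = ∫ t in (-1 / 8 : ℝ)..1 / 8, (f t + f ((t + 1 / 2 : ℝ) : AddCircle (1 : ℝ)) +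
      f ((t + 1 / 4 : ℝ) : AddCircle (1 : ℝ)) + f ((t + 3 / 4 : ℝ) : AddCircle (1 : ℝ))) := by
  have hc : Continuous fun t : ℝ => f t := hf.comp (AddCircle.continuous_mk' 1)
  have hi : ∀ a b, IntervalIntegrable (fun t : ℝ => f t) volume a b := fun a b =>
    hc.intervalIntegrable a b
  have hs : ∀ d : ℝ, IntervalIntegrable (fun t : ℝ => f ((t + d : ℝ) : AddCircle (1 : ℝ)))
      volume (-1 / 8) (1 / 8) := fun d =>
    (hc.comp (by fun_prop : Continuous fun t : ℝ => t + d)).intervalIntegrable _ _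
  rw [intervalIntegral.integral_add (((hi _ _).add (hs _)).add (hs _)) (hs _),
    intervalIntegral.integral_add ((hi _ _).add (hs _)) (hs _),
    intervalIntegral.integral_add (hi _ _) (hs _),
    intervalIntegral.integral_comp_add_right (fun t : ℝ => f t),
    intervalIntegral.integral_comp_add_right (fun t : ℝ => f t),
    intervalIntegral.integral_comp_add_right (fun t : ℝ => f t),
    ← AddCircle.intervalIntegral_preimage 1 (-1 / 8),
    ← intervalIntegral.integral_add_adjacent_intervals (hi (-1 / 8) (1 / 8)) (hi _ _),
    ← intervalIntegral.integral_add_adjacent_intervals (hi (1 / 8) (3 / 8)) (hi _ _),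
    ← intervalIntegral.integral_add_adjacent_intervals (hi (3 / 8) (5 / 8)) (hi _ _)]
  norm_num
  ring

theorem squareCos_squareSin_quarters {t : ℝ} (ht : |t| ≤ 1 / 8) (U : ℝ → ℝ → ℝ) (r : ℝ) :
    U (r * squareCos t) (r * squareSin t) = U r (r * (8 * t)) ∧
    U (r * squareCos ((t + 1 / 2 : ℝ) : AddCircle (1 : ℝ)))
      (r * squareSin ((t + 1 / 2 : ℝ) : AddCircle (1 : ℝ))) = U (-r) (-(r * (8 * t))) ∧
    U (r * squareCos ((t + 1 / 4 : ℝ) : AddCircle (1 : ℝ)))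
      (r * squareSin ((t + 1 / 4 : ℝ) : AddCircle (1 : ℝ))) = U (-(r * (8 * t))) r ∧
    U (r * squareCos ((t + 3 / 4 : ℝ) : AddCircle (1 : ℝ)))
      (r * squareSin ((t + 3 / 4 : ℝ) : AddCircle (1 : ℝ))) = U (r * (8 * t)) (-r) := by
  have h1 : ((t + 1 / 2 : ℝ) : AddCircle (1 : ℝ)) = (t : AddCircle (1 : ℝ)) +
    ((1 / 4 : ℝ) : AddCircle (1 : ℝ)) + ((1 / 4 : ℝ) : AddCircle (1 : ℝ)) := by
      rw [← AddCircle.coe_add, ← AddCircle.coe_add]; congr 1; ring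
  have h2 : ((t + 3 / 4 : ℝ) : AddCircle (1 : ℝ)) = (t : AddCircle (1 : ℝ)) +
    ((1 / 4 : ℝ) : AddCircle (1 : ℝ)) + ((1 / 4 : ℝ) : AddCircle (1 : ℝ)) +
      ((1 / 4 : ℝ) : AddCircle (1 : ℝ)) := by
      rw [← AddCircle.coe_add, ← AddCircle.coe_add, ← AddCircle.coe_add]; congr 1; ring
  rw [h1, h2, AddCircle.coe_add]
  simp only [squareCos_add_quarter, squareSin_add_quarter, squareCos_of_abs_le ht,
    squareSin_of_abs_le ht, mul_one, mul_neg, neg_neg, and_self]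

theorem integral_square_eq_polar {U : ℝ → ℝ → ℝ} (hU : Continuous fun z : ℝ × ℝ => U z.1 z.2) :
    ∫ x in (-1 : ℝ)..1, ∫ y in (-1 : ℝ)..1, U x y =
      ∫ r in (0 : ℝ)..1, 8 * r * ∫ θ, U (r * squareCos θ) (r * squareSin θ) := by
  rw [integral_square_eq hU]
  refine intervalIntegral.integral_congr fun r hr => ?_
  have hc := continuous_squareCos
  have hs := continuous_squareSin
  rw [integral_addCircle_eq_quarters (f := fun θ => U (r * squareCos θ) (r * squareSin θ)) (hU.comp
    (by fun_prop : Continuous fun θ => (r * squareCos θ, r * squareSin θ)))]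
  have : ∫ t in (-1 / 8 : ℝ)..1 / 8, (fun t => U r t + U (-r) (-t) + U (-t) r + U t (-r))
      (8 * r * t) = ∫ t in (-1 / 8 : ℝ)..1 / 8, 
      (U (r * squareCos t) (r * squareSin t) + 
      U (r * squareCos ((t + 1 / 2 : ℝ) : AddCircle (1 : ℝ)))
      (r * squareSin ((t + 1 / 2 : ℝ) : AddCircle (1 : ℝ))) +
      U (r * squareCos ((t + 1 / 4 : ℝ) : AddCircle (1 : ℝ)))
      (r * squareSin ((t + 1 / 4 : ℝ) : AddCircle (1 : ℝ))) +
      U (r * squareCos ((t + 3 / 4 : ℝ) : AddCircle (1 : ℝ)))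
      (r * squareSin ((t + 3 / 4 : ℝ) : AddCircle (1 : ℝ)))) := by
    refine intervalIntegral.integral_congr fun t ht => ?_
    rw [uIcc_of_le (by norm_num)] at ht
    obtain ⟨h1, h2, h3, h4⟩ := squareCos_squareSin_quarters (t := t)
      (abs_le.2 ⟨by linarith [ht.1], ht.2⟩) U r
    simp only [h1, h2, h3, h4, show 8 * r * t = r * (8 * t) by ring]
  refine Eq.trans ?_ (congrArg (8 * r * ·) this)
  simp only
  rw [intervalIntegral.mul_integral_comp_mul_left
    (f := fun t => U r t + U (-r) (-t) + U (-t) r + U t (-r))]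
  congr 1 <;> ring

/-- Measures on a compact metrizable space are preserved by a continuous map as soon as integrals
of continuous functions are. -/
theorem measurePreserving_of_integral_comp_eq {X : Type*} [TopologicalSpace X] [MeasurableSpace X]
    [BorelSpace X] [HasOuterApproxClosed X] {μ : Measure X} [IsFiniteMeasure μ] (T : C(X, X))
    (h : ∀ u : C(X, ℝ), ∫ x, u (T x) ∂μ = ∫ x, u x ∂μ) : MeasurePreserving T μ μ := by
  refine ⟨T.continuous.measurable, ext_of_forall_integral_eq_of_IsFiniteMeasure fun u => ?_⟩
  rw [integral_map T.continuous.aemeasurable u.continuous.aestronglyMeasurable]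
  exact h u.toContinuousMap

theorem integral_square_eq_intervalIntegral {U : ℝ → ℝ → ℝ}
    (hU : Continuous fun z : ℝ × ℝ => U z.1 z.2) :
    ∫ q : Square, U q.1 q.2 = ∫ x in (-1 : ℝ)..1, ∫ y in (-1 : ℝ)..1, U x y := by
  rw [Measure.volume_eq_prod, integral_prod]
  · simp only [integral_Icc_subtype (U _)]
    exact integral_Icc_subtype (fun x => ∫ y in (-1 : ℝ)..1, U x y)
  · refine Continuous.integrable_of_hasCompactSupport ?_ (HasCompactSupport.of_compactSpace _)
    exact hU.comp (by fun_prop : Continuous fun q : Square => ((q.1 : ℝ), (q.2 : ℝ)))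

theorem integral_eq_polar (u : C(Square, ℝ)) :
    ∫ q, u q = ∫ r in (0 : ℝ)..1, 8 * r * ∫ θ, u (squarePolar (projIcc 0 1 zero_le_one r, θ)) := by
  have h := integral_square_eq_intervalIntegral
    (U := fun x y => u (projIcc (-1) 1 (by norm_num) x, projIcc (-1) 1 (by norm_num) y))
    (by fun_prop)
  simp only [projIcc_val, Prod.mk.eta] at h
  rw [h, integral_square_eq_polar (by fun_prop)]
  refine intervalIntegral.integral_congr fun r hr => ?_
  rw [uIcc_of_le zero_le_one] at hr
  have : ∀ θ, squarePolar (projIcc 0 1 zero_le_one r, θ) =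
      (projIcc (-1) 1 (by norm_num) (r * squareCos θ),
        projIcc (-1) 1 (by norm_num) (r * squareSin θ)) := by
    intro θ
    rw [projIcc_of_mem _ hr]
    refine Prod.ext ?_ ?_
    · exact (projIcc_of_mem (by norm_num) (squarePolar (⟨r, hr⟩, θ)).1.2).symm
    · exact (projIcc_of_mem (by norm_num) (squarePolar (⟨r, hr⟩, θ)).2.2).symm
  simp only [this]

theorem measurePreserving_squareTwist (η s : ℝ) :
    MeasurePreserving (fun q => squareTwist η (s, q)) volume volume := by
  refine measurePreserving_of_integral_comp_eq
    ((squareTwist η).comp ⟨fun q => (s, q), by fun_prop⟩) fun u => ?_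
  have h := integral_eq_polar
    (u.comp ((squareTwist η).comp ⟨fun q => (s, q), by fun_prop⟩))
  simp only [ContinuousMap.comp_apply, ContinuousMap.coe_mk, squareTwist_squarePolar] at h ⊢
  rw [h, integral_eq_polar u]
  refine intervalIntegral.integral_congr fun r hr => congrArg (8 * r * ·) ?_
  exact integral_add_right_eq_self
    (fun θ => u (squarePolar (projIcc 0 1 zero_le_one r, θ))) _

/-- A homeomorphism of the closed annulus preserving area and the boundary, together with the
displacement of a lift. -/
structure LiftedHomeo where
  toFun : C(Annulus, Annulus)
  inv : C(Annulus, Annulus)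
  disp : C(Annulus, ℝ)
  inv_toFun : ∀ z, inv (toFun z) = z
  toFun_inv : ∀ z, toFun (inv z) = z
  fst_toFun : ∀ z, (toFun z).1 = z.1 + (disp z : AddCircle (1 : ℝ))
  measurePreserving : MeasurePreserving toFun volume volume
  abs_snd_eq_one : ∀ z, |((toFun z).2 : ℝ)| = 1 ↔ |(z.2 : ℝ)| = 1

namespace LiftedHomeo

/-- The identity. -/
def refl : LiftedHomeo where
  toFun := ContinuousMap.id _
  inv := ContinuousMap.id _
  disp := 0
  inv_toFun _ := rfl
  toFun_inv _ := rfl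
  fst_toFun z := by simp
  measurePreserving := MeasurePreserving.id _
  abs_snd_eq_one _ := Iff.rfl

/-- Composition `k ∘ h`. -/
def comp (k h : LiftedHomeo) : LiftedHomeo where
  toFun := k.toFun.comp h.toFun
  inv := h.inv.comp k.inv
  disp := h.disp + k.disp.comp h.toFun
  inv_toFun z := by simp [k.inv_toFun, h.inv_toFun]
  toFun_inv z := by simp [k.toFun_inv, h.toFun_inv]
  fst_toFun z := by
    simp only [ContinuousMap.comp_apply, k.fst_toFun, h.fst_toFun, ContinuousMap.add_apply,
      AddCircle.coe_add, add_assoc]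
  measurePreserving := k.measurePreserving.comp h.measurePreserving
  abs_snd_eq_one z := (k.abs_snd_eq_one _).trans (h.abs_snd_eq_one z)

end LiftedHomeo

theorem squareRadius_eq_one_of_fst {q : Square} (h : |(q.1 : ℝ)| = 1) :
    (squareRadius q : ℝ) = 1 :=
  le_antisymm (squareRadius q).2.2 (h.symm.le.trans (le_max_left _ _))

theorem squareRadius_eq_one_of_snd {q : Square} (h : |(q.2 : ℝ)| = 1) :
    (squareRadius q : ℝ) = 1 :=
  le_antisymm (squareRadius q).2.2 (h.symm.le.trans (le_max_right _ _))

namespace StripTiling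

variable {ι : Type} [Fintype ι] (𝒯 : StripTiling ι)

/-- Parametrization of the `i`-th strip of the annulus by the square. -/
def strip (i : ι) (q : Square) : Annulus := (𝒯.param i q.1, q.2)

theorem continuous_strip (i : ι) : Continuous (𝒯.strip i) :=
  ((𝒯.continuous_param i).comp continuous_fst).prodMk continuous_snd

theorem exists_strip_eq (z : Annulus) : ∃ i q, 𝒯.strip i q = z := by
  obtain ⟨i, X, h⟩ := 𝒯.exists_param_eq z.1
  exact ⟨i, (X, z.2), Prod.ext h rfl⟩

theorem strip_eq_strip {i k : ι} {q q' : Square} (h : 𝒯.strip i q = 𝒯.strip k q') :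
    (i = k ∧ q = q') ∨ ((squareRadius q : ℝ) = 1 ∧ (squareRadius q' : ℝ) = 1) := by
  obtain ⟨h1, h2⟩ := Prod.mk.inj h
  rcases 𝒯.param_eq_param h1 with h3 | h3
  · exact Or.inl ⟨h3.1, Prod.ext h3.2 h2⟩
  · exact Or.inr ⟨squareRadius_eq_one_of_fst h3.1, squareRadius_eq_one_of_fst h3.2⟩

theorem exists_glue {Z : Type*} [TopologicalSpace Z] (g : ι → Square → Z)
    (hg : ∀ i, Continuous (g i))
    (h : ∀ i k q q', 𝒯.strip i q = 𝒯.strip k q' → (squareRadius q : ℝ) = 1 →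
      (squareRadius q' : ℝ) = 1 → g i q = g k q') :
    ∃ G : C(Annulus, Z), ∀ i q, G (𝒯.strip i q) = g i q := by
  obtain ⟨G, hG⟩ := exists_continuousMap_comp_eq (X := Σ _ : ι, Square)
    (Φ := fun z => 𝒯.strip z.1 z.2) (continuous_sigma 𝒯.continuous_strip)
    (fun z => by
      obtain ⟨i, q, h⟩ := 𝒯.exists_strip_eq z
      exact ⟨⟨i, q⟩, h⟩)
    (g := fun z => g z.1 z.2) (continuous_sigma hg) (by
      rintro ⟨i, q⟩ ⟨k, q'⟩ hz
      rcases 𝒯.strip_eq_strip hz with ⟨h1, h2⟩ | ⟨h1, h2⟩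
      · simp only at h1 h2
        rw [h1, h2]
      · exact h i k q q' hz h1 h2)
  exact ⟨G, fun i q => hG ⟨i, q⟩⟩

theorem integral_annulus_eq_sum (u : C(Annulus, ℝ)) :
    ∫ z, u z = ∑ i, 𝒯.w i / 2 * ∫ q, u (𝒯.strip i q) := by
  have hinteg : ∀ i, Integrable (fun q => u (𝒯.strip i q)) := fun i =>
    (u.continuous.comp (𝒯.continuous_strip i)).integrable_of_hasCompactSupport
      (HasCompactSupport.of_compactSpace _)
  have h1 : ∀ i, ∫ q, u (𝒯.strip i q) = ∫ y, ∫ X, u (𝒯.strip i (X, y)) := fun i => by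
    rw [Measure.volume_eq_prod, integral_prod_symm _ (hinteg i)]
  have h2 : ∀ i, Integrable (fun y => ∫ X, u (𝒯.strip i (X, y))) := fun i =>
    (hinteg i).integral_prod_right
  rw [Measure.volume_eq_prod, integral_prod_symm _
    (u.continuous.integrable_of_hasCompactSupport (HasCompactSupport.of_compactSpace _))]
  have h3 : ∀ i, 𝒯.w i / 2 * ∫ q, u (𝒯.strip i q) =
      ∫ y, 𝒯.w i / 2 * ∫ X, u (𝒯.strip i (X, y)) := fun i => by
    rw [h1, integral_const_mul]
  rw [Finset.sum_congr rfl fun i _ => h3 i,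
    ← integral_finsetSum _ fun i _ => (h2 i).const_mul _]
  congr 1
  ext y
  exact 𝒯.integral_eq_sum (g := fun x => u (x, y)) (by fun_prop)

variable (η : ℝ) (s : ι → ℝ)

theorem exists_twistFun : ∃ G : C(Annulus, Annulus), ∀ i q,
    G (𝒯.strip i q) = 𝒯.strip i (squareTwist η (s i, q)) :=
  𝒯.exists_glue _ (fun i => (𝒯.continuous_strip i).comp (by fun_prop)) fun i k q q' h h1 h2 => by
    rwa [squareTwist_of_radius_eq_one _ h1, squareTwist_of_radius_eq_one _ h2]

/-- The map acting on the `i`-th strip by the twist at time `s i`. -/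
def twistFun : C(Annulus, Annulus) := (𝒯.exists_twistFun η s).choose

theorem twistFun_strip (i : ι) (q : Square) :
    𝒯.twistFun η s (𝒯.strip i q) = 𝒯.strip i (squareTwist η (s i, q)) :=
  (𝒯.exists_twistFun η s).choose_spec i q

theorem exists_twistDisp : ∃ G : C(Annulus, ℝ), ∀ i q,
    G (𝒯.strip i q) = 𝒯.w i / 2 * ((squareTwist η (s i, q)).1 - q.1) :=
  𝒯.exists_glue _ (fun i => by fun_prop) fun i k q q' h h1 h2 => by
    rw [squareTwist_of_radius_eq_one _ h1, squareTwist_of_radius_eq_one _ h2]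
    simp

/-- The displacement of `twistFun`. -/
def twistDisp : C(Annulus, ℝ) := (𝒯.exists_twistDisp η s).choose

theorem twistDisp_strip (i : ι) (q : Square) :
    𝒯.twistDisp η s (𝒯.strip i q) = 𝒯.w i / 2 * ((squareTwist η (s i, q)).1 - q.1) :=
  (𝒯.exists_twistDisp η s).choose_spec i q

theorem twistFun_neg_twistFun (z : Annulus) :
    𝒯.twistFun η (-s) (𝒯.twistFun η s z) = z := by
  obtain ⟨i, q, rfl⟩ := 𝒯.exists_strip_eq z
  rw [twistFun_strip, twistFun_strip, ← squareTwist_add, Pi.neg_apply, neg_add_cancel,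
    squareTwist_zero]

theorem measurePreserving_twistFun : MeasurePreserving (𝒯.twistFun η s) volume volume := by
  refine measurePreserving_of_integral_comp_eq _ fun u => ?_
  have h := 𝒯.integral_annulus_eq_sum (u.comp (𝒯.twistFun η s))
  simp only [ContinuousMap.comp_apply, twistFun_strip] at h
  rw [h, 𝒯.integral_annulus_eq_sum u]
  refine Finset.sum_congr rfl fun i _ => ?_
  congr 1
  have hmp := measurePreserving_squareTwist η (s i)
  have := integral_map (μ := volume) hmp.measurable.aemeasurable (f := fun q => u (𝒯.strip i q))
    (u.continuous.comp (𝒯.continuous_strip i)).aestronglyMeasurable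
  rw [hmp.map_eq] at this
  exact this.symm

/-- The homeomorphism acting on the `i`-th strip by the twist at time `s i`. -/
def twist : LiftedHomeo where
  toFun := 𝒯.twistFun η s
  inv := 𝒯.twistFun η (-s)
  disp := 𝒯.twistDisp η s
  inv_toFun := 𝒯.twistFun_neg_twistFun η s
  toFun_inv z := by simpa using 𝒯.twistFun_neg_twistFun η (-s) z
  fst_toFun z := by
    obtain ⟨i, q, rfl⟩ := 𝒯.exists_strip_eq z
    rw [twistFun_strip, twistDisp_strip]
    simp only [strip, param]
    rw [← AddCircle.coe_add]
    congr 1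
    ring
  measurePreserving := 𝒯.measurePreserving_twistFun η s
  abs_snd_eq_one := by
    have key : ∀ s (z : Annulus), |(z.2 : ℝ)| = 1 → |((𝒯.twistFun η s z).2 : ℝ)| = 1 := by
      intro s z h
      obtain ⟨i, q, rfl⟩ := 𝒯.exists_strip_eq z
      rwa [twistFun_strip, squareTwist_of_radius_eq_one _ (squareRadius_eq_one_of_snd h)]
    refine fun z => ⟨fun h => ?_, key s z⟩
    have := key (-s) _ h
    rwa [twistFun_neg_twistFun] at this

end StripTiling

/-- The rigid rotation of the annulus. -/
def annulusRotation (β : ℝ) : C(Annulus, Annulus) where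
  toFun z := (z.1 + (β : AddCircle (1 : ℝ)), z.2)
  continuous_toFun := by fun_prop

theorem annulusRotation_apply (β : ℝ) (z : Annulus) :
    annulusRotation β z = (z.1 + (β : AddCircle (1 : ℝ)), z.2) := rfl

theorem exists_dist_squareTwist_le (η : ℝ) {ε : ℝ} (hε : 0 < ε) :
    ∃ δ > 0, ∀ s, |s| ≤ δ → ∀ q, dist (squareTwist η (s, q)) q ≤ ε := by
  have h : ∀ᶠ s in nhds (0 : ℝ), ∀ q ∈ (univ : Set Square), dist (squareTwist η (s, q)) q < ε := by
    refine isCompact_univ.eventually_forall_of_forall_eventually fun q _ => ?_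
    have hc : Continuous fun z : ℝ × Square => dist (squareTwist η (z.1, z.2)) z.2 := by fun_prop
    refine hc.continuousAt.eventually_lt continuousAt_const ?_
    simpa [squareTwist_zero] using hε
  obtain ⟨δ, hδ, h⟩ := Metric.eventually_nhds_iff.1 h
  refine ⟨δ / 2, by positivity, fun s hs q => (h ?_ q (mem_univ q)).le⟩
  rw [Real.dist_eq, sub_zero]
  linarith

theorem abs_sub_le_two (X X' : Icc (-1 : ℝ) 1) : |(X : ℝ) - X'| ≤ 2 := by
  rw [abs_le]
  constructor <;> linarith [X.2.1, X.2.2, X'.2.1, X'.2.2]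

namespace StripTiling

variable {ι : Type} [Fintype ι] (𝒯 : StripTiling ι) (η : ℝ) (s : ι → ℝ)

theorem dist_param_le (i : ι) (X X' : Icc (-1 : ℝ) 1) :
    dist (𝒯.param i X) (𝒯.param i X') ≤ 𝒯.w i := by
  rw [param, param, dist_eq_norm, ← AddCircle.coe_sub]
  refine QuotientAddGroup.norm_mk_le_norm.trans ?_
  have h := abs_sub_le_two X X'
  have hw := 𝒯.w_pos i
  rw [Real.norm_eq_abs, show 𝒯.c i + 𝒯.w i * (1 + X) / 2 - (𝒯.c i + 𝒯.w i * (1 + X') / 2) =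
    𝒯.w i / 2 * (X - X') by ring, abs_mul, abs_of_pos (by linarith)]
  nlinarith

theorem abs_twist_disp_le {ε : ℝ} (hε : ∀ i, 𝒯.w i < ε) (z : Annulus) :
    |(𝒯.twist η s).disp z| ≤ ε := by
  obtain ⟨i, q, rfl⟩ := 𝒯.exists_strip_eq z
  have h := abs_sub_le_two (squareTwist η (s i, q)).1 q.1
  have hw := 𝒯.w_pos i
  refine le_trans ?_ (hε i).le
  rw [twist, twistDisp_strip, abs_mul, abs_of_pos (by linarith)]
  nlinarith

theorem rotation_strip {α : ℝ} {i k : ι} (hc : 𝒯.c k = 𝒯.c i + α) (hw : 𝒯.w k = 𝒯.w i)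
    (q : Square) : annulusRotation α (𝒯.strip i q) = 𝒯.strip k q := by
  refine Prod.ext ?_ rfl
  simp only [annulusRotation_apply, strip, param, ← AddCircle.coe_add, hc, hw]
  congr 1
  ring

end StripTiling

theorem RampedTiling.dist_twist_rotation_le {α δ ε η κ : ℝ} {ι : Type} [Fintype ι]
    (𝒯 : RampedTiling α δ ε ι)
    (hδ : ∀ s, |s| ≤ δ → ∀ q, dist (squareTwist η (s, q)) q ≤ κ) (hκ : 0 ≤ κ) (hε : 2 * ε ≤ κ)
    (z : Annulus) :
    dist ((𝒯.toStripTiling.twist η 𝒯.s).toFun (annulusRotation α z))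
      (annulusRotation α ((𝒯.toStripTiling.twist η 𝒯.s).toFun z)) ≤ κ := by
  set h := 𝒯.toStripTiling.twist η 𝒯.s with hh
  have hstrip : ∀ i q, h.toFun (𝒯.strip i q) = 𝒯.strip i (squareTwist η (𝒯.s i, q)) :=
    𝒯.toStripTiling.twistFun_strip η 𝒯.s
  have hD : ∀ z, |h.disp z| ≤ ε := 𝒯.toStripTiling.abs_twist_disp_le η 𝒯.s 𝒯.w_lt
  refine max_le ?_ ?_
  · rw [h.fst_toFun, annulusRotation_apply, annulusRotation_apply, h.fst_toFun, dist_eq_norm]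
    have : z.1 + (α : AddCircle (1 : ℝ)) + (h.disp (z.1 + (α : AddCircle (1 : ℝ)), z.2)) -
        (z.1 + h.disp z + (α : AddCircle (1 : ℝ))) =
        ((h.disp (z.1 + (α : AddCircle (1 : ℝ)), z.2) - h.disp z : ℝ) : AddCircle (1 : ℝ)) := by
      rw [AddCircle.coe_sub]; abel
    simp only [this]
    refine QuotientAddGroup.norm_mk_le_norm.trans ((abs_sub _ _).trans ?_)
    linarith [hD z, hD (z.1 + (α : AddCircle (1 : ℝ)), z.2)]
  · have key : ∀ {i k} q, 𝒯.c k = 𝒯.c i + α → 𝒯.w k = 𝒯.w i → |𝒯.s k - 𝒯.s i| ≤ δ →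
        dist (h.toFun (annulusRotation α (𝒯.strip i q))).2
          (annulusRotation α (h.toFun (𝒯.strip i q))).2 ≤ κ := by
      intro i k q hc hw hs
      rw [𝒯.rotation_strip hc hw, hstrip, hstrip, annulusRotation_apply]
      refine le_trans ?_ (hδ _ hs (squareTwist η (𝒯.s i, q)))
      rw [← squareTwist_add, sub_add_cancel]
      exact le_max_right _ _
    obtain ⟨i, q, rfl⟩ := 𝒯.exists_strip_eq z
    rcases 𝒯.succ i with hi | ⟨k, hc, hw, hs⟩
    · obtain ⟨k, q', hk⟩ := 𝒯.exists_strip_eq (annulusRotation α (𝒯.strip i q))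
      rcases 𝒯.pred k with hk0 | ⟨l, hc, hw, hs⟩
      · rw [← hk, hstrip, hstrip, hi, hk0, squareTwist_zero, squareTwist_zero, hk, dist_self]
        exact hκ
      · have : 𝒯.strip i q = 𝒯.strip l q' := by
          rw [← 𝒯.rotation_strip hc hw] at hk
          have h1 := congrArg Prod.fst hk
          have h2 := congrArg Prod.snd hk
          exact Prod.ext (add_right_cancel h1.symm) h2.symm
        rw [this]
        exact key q' hc hw hs
    · exact key q hc hw hs

/-- The characteristic function of the points of `[-1,1]` at distance less than `η` from its
boundary. -/
def endIndicator (η : ℝ) (X : ℝ) : ℝ := 1 - {y : ℝ | |y| ≤ 1 - η}.indicator 1 X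

theorem endIndicator_nonneg (η X : ℝ) : 0 ≤ endIndicator η X := by
  rw [endIndicator, sub_nonneg]
  exact indicator_le_self' (fun _ _ => zero_le_one) X

theorem endIndicator_of_lt {η X : ℝ} (h : 1 - η < |X|) : endIndicator η X = 1 := by
  rw [endIndicator, indicator_of_notMem (by simpa using h), sub_zero]

theorem measurable_endIndicator (η : ℝ) : Measurable (endIndicator η) :=
  measurable_const.sub (measurable_one.indicator (measurableSet_le measurable_norm measurable_const))

theorem endIndicator_le_one (η X : ℝ) : endIndicator η X ≤ 1 := by
  rw [endIndicator, sub_le_self_iff]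
  exact indicator_nonneg (fun _ _ => zero_le_one) X

theorem integrable_endIndicator (η : ℝ) :
    Integrable (fun X : Icc (-1 : ℝ) 1 => endIndicator η X) := by
  refine Integrable.of_bound (C := 1)
    ((measurable_endIndicator η).comp measurable_subtype_coe).aestronglyMeasurable
    (Filter.Eventually.of_forall fun X => ?_)
  rw [Real.norm_eq_abs, abs_of_nonneg (endIndicator_nonneg _ _)]
  exact endIndicator_le_one _ _

theorem integral_endIndicator {η : ℝ} (h0 : 0 < η) (h1 : η < 1) :
    ∫ X : Icc (-1 : ℝ) 1, endIndicator η X = 2 * η := by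
  rw [integral_Icc_subtype]
  simp only [endIndicator]
  rw [intervalIntegral.integral_sub intervalIntegrable_const, integral_indicator_abs_le _ (by linarith)
    (by linarith)]
  · simp
    ring
  · refine IntervalIntegrable.mono_fun (f := fun _ => (1 : ℝ)) intervalIntegrable_const
      (measurable_one.indicator (measurableSet_le measurable_norm measurable_const)).aestronglyMeasurable
      (Filter.Eventually.of_forall fun x => ?_)
    exact (norm_indicator_le_norm_self _ _).trans (by simp)

theorem measureReal_univ_Icc : volume.real (univ : Set (Icc (-1 : ℝ) 1)) = 2 := by
  simp [Measure.real, volume_univ_Icc]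

theorem measureReal_univ_square : volume.real (univ : Set Square) = 4 := by
  rw [Measure.volume_eq_prod, ← univ_prod_univ, measureReal_prod_prod, measureReal_univ_Icc]
  norm_num

theorem measureReal_univ_addCircle : volume.real (univ : Set (AddCircle (1 : ℝ))) = 1 := by
  simp [Measure.real, AddCircle.measure_univ]

theorem volume_univ_annulus : volume (univ : Set Annulus) = 2 := by
  rw [Measure.volume_eq_prod, ← univ_prod_univ, Measure.prod_prod, volume_univ_Icc,
    AddCircle.measure_univ, ENNReal.ofReal_one, one_mul]

theorem measureReal_univ_annulus : volume.real (univ : Set Annulus) = 2 := by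
  simp [Measure.real, volume_univ_annulus]

theorem integrable_of_continuous {X : Type*} [TopologicalSpace X] [MeasurableSpace X]
    [BorelSpace X] [CompactSpace X] {μ : Measure X} [IsFiniteMeasure μ] {f : X → ℝ}
    (hf : Continuous f) : Integrable f μ :=
  hf.integrable_of_hasCompactSupport (HasCompactSupport.of_compactSpace f)

theorem abs_integral_le_mul {X : Type*} [MeasurableSpace X] {μ : Measure X} [IsFiniteMeasure μ]
    {f : X → ℝ} {C : ℝ} (h : ∀ x, |f x| ≤ C) : |∫ x, f x ∂μ| ≤ C * μ.real univ := by
  rw [← Real.norm_eq_abs]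
  exact norm_integral_le_of_norm_le_const (Filter.Eventually.of_forall h)

namespace StripTiling

variable {ι : Type} [Fintype ι] (𝒯 : StripTiling ι) {η : ℝ} (v : C(Annulus, ℝ))

theorem abs_apply_le (z : Annulus) : |v z| ≤ ‖v‖ := v.norm_coe_le_norm z

theorem abs_strip_average_sub_le (i : ι) (s : ℝ) (y : Icc (-1 : ℝ) 1) :
    |(∫ X, v (𝒯.strip i (squareTwist η (s, (X, y))))) - (∫ q, v (𝒯.strip i q)) / 2| ≤ 4 * ‖v‖ := by
  have h1 := abs_integral_le_mul (μ := (volume : Measure (Icc (-1 : ℝ) 1)))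
    (fun X => abs_apply_le v (𝒯.strip i (squareTwist η (s, (X, y)))))
  have h2 := abs_integral_le_mul (μ := (volume : Measure Square))
    (fun q => abs_apply_le v (𝒯.strip i q))
  rw [measureReal_univ_Icc] at h1
  rw [measureReal_univ_square] at h2
  refine (abs_sub _ _).trans ?_
  rw [abs_div, abs_two]
  linarith

theorem dist_strip_le (i : ι) (X X' Y : Icc (-1 : ℝ) 1) :
    dist (𝒯.strip i (X, Y)) (𝒯.strip i (X', Y)) ≤ 𝒯.w i := by
  refine max_le (𝒯.dist_param_le i X X') ?_
  simpa [strip] using (𝒯.w_pos i).le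

theorem abs_strip_twist_sub_le {ω : ℝ} (h0 : 0 < η)
    {i : ι} (hω : ∀ z z', dist z z' ≤ 𝒯.w i → |v z - v z'| ≤ ω)
    (Z X y : Icc (-1 : ℝ) 1) :
    |v (𝒯.strip i (squareTwist η (1, (X, y)))) - v (𝒯.strip i (Z, X))| ≤
      ω + 2 * ‖v‖ * endIndicator η y + 2 * ‖v‖ * endIndicator η X := by
  have hω0 : 0 ≤ ω := (abs_nonneg _).trans (hω (𝒯.strip i (Z, X)) (𝒯.strip i (Z, X))
    (by simpa using (𝒯.w_pos i).le))
  have hM := norm_nonneg v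
  have e1 := mul_nonneg (mul_nonneg zero_le_two hM) (endIndicator_nonneg η X)
  have e2 := mul_nonneg (mul_nonneg zero_le_two hM) (endIndicator_nonneg η y)
  by_cases hq : (squareRadius (X, y) : ℝ) ≤ 1 - η
  · rw [squareTwist_one h0 hq]
    refine (hω _ _ (𝒯.dist_strip_le i _ _ _)).trans (by linarith)
  · have h1 : |v (𝒯.strip i (squareTwist η (1, (X, y)))) - v (𝒯.strip i (Z, X))| ≤ 2 * ‖v‖ := by
      refine (abs_sub _ _).trans ?_
      linarith [abs_apply_le v (𝒯.strip i (squareTwist η (1, (X, y)))),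
        abs_apply_le v (𝒯.strip i (Z, X))]
    rcases lt_max_iff.1 (not_le.1 hq) with h | h
    · rw [endIndicator_of_lt h]; linarith
    · rw [endIndicator_of_lt h]; linarith

theorem abs_strip_average_sub_le_of_good {ω : ℝ} (h0 : 0 < η) (h1 : η < 1)
    {i : ι} (hω : ∀ z z', dist z z' ≤ 𝒯.w i → |v z - v z'| ≤ ω) (y : Icc (-1 : ℝ) 1) :
    |(∫ X, v (𝒯.strip i (squareTwist η (1, (X, y))))) - (∫ q, v (𝒯.strip i q)) / 2| ≤
      4 * ω + 4 * ‖v‖ * η + 4 * ‖v‖ * endIndicator η y := by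
  set Z : Icc (-1 : ℝ) 1 := ⟨0, by norm_num, by norm_num⟩
  have hs := 𝒯.continuous_strip i
  have hc1 : Continuous fun X => v (𝒯.strip i (squareTwist η (1, (X, y)))) := by fun_prop
  have hc2 : Continuous fun X => v (𝒯.strip i (Z, X)) := by fun_prop
  have hc3 : Continuous fun q => v (𝒯.strip i q) := by fun_prop
  have hc4 : Continuous fun q : Square => v (𝒯.strip i (Z, q.2)) := by fun_prop
  have hJ := (integrable_endIndicator η).const_mul (2 * ‖v‖)
  have a1 : |(∫ X, v (𝒯.strip i (squareTwist η (1, (X, y))))) - ∫ X, v (𝒯.strip i (Z, X))| ≤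
      2 * ω + 4 * ‖v‖ * η + 4 * ‖v‖ * endIndicator η y := by
    rw [← integral_sub (integrable_of_continuous hc1) (integrable_of_continuous hc2),
      ← Real.norm_eq_abs]
    refine (norm_integral_le_of_norm_le
      (g := fun X : Icc (-1 : ℝ) 1 => (ω + 2 * ‖v‖ * endIndicator η y) + 2 * ‖v‖ * endIndicator η X)
      ((integrable_const _).add hJ)
      (Filter.Eventually.of_forall fun X => 𝒯.abs_strip_twist_sub_le v h0 hω Z X y)).trans ?_
    rw [integral_add (integrable_const _) hJ, integral_const, integral_const_mul,
      integral_endIndicator h0 h1, measureReal_univ_Icc, smul_eq_mul]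
    linarith
  have a2 : |(∫ q, v (𝒯.strip i q)) - 2 * ∫ X, v (𝒯.strip i (Z, X))| ≤ 4 * ω := by
    have : 2 * ∫ X, v (𝒯.strip i (Z, X)) = ∫ q : Square, v (𝒯.strip i (Z, q.2)) := by
      rw [Measure.volume_eq_prod, integral_fun_snd (fun X => v (𝒯.strip i (Z, X))),
        measureReal_univ_Icc, smul_eq_mul]
    rw [this, ← integral_sub (integrable_of_continuous hc3) (integrable_of_continuous hc4)]
    refine (abs_integral_le_mul (C := ω) fun q => hω _ _ (𝒯.dist_strip_le i _ _ _)).trans ?_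
    rw [measureReal_univ_square]
    linarith
  rw [abs_le] at a1 a2 ⊢
  constructor <;> linarith [a1.1, a1.2, a2.1, a2.2]

end StripTiling

theorem RampedTiling.integral_abs_average_sub_le {α δ ε η ω : ℝ} {ι : Type} [Fintype ι]
    (𝒯 : RampedTiling α δ ε ι) (v : C(Annulus, ℝ)) (h0 : 0 < η) (h1 : η < 1)
    (hω : ∀ z z', dist z z' ≤ ε → |v z - v z'| ≤ ω) :
    ∫ y, |(∫ x, v ((𝒯.toStripTiling.twist η 𝒯.s).toFun (x, y))) - (∫ z, v z) / 2| ≤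
      4 * ω + 8 * ‖v‖ * η + 4 * ‖v‖ * ε := by
  set h := 𝒯.toStripTiling.twist η 𝒯.s
  have hM := norm_nonneg v
  have hpt : ∀ y, |(∫ x, v (h.toFun (x, y))) - (∫ z, v z) / 2| ≤
      (2 * ω + 2 * ‖v‖ * η + 2 * ‖v‖ * ε) + 2 * ‖v‖ * endIndicator η y := by
    intro y
    rw [𝒯.integral_eq_sum (g := fun x => v (h.toFun (x, y))) (by fun_prop),
      𝒯.integral_annulus_eq_sum v, Finset.sum_div, ← Finset.sum_sub_distrib]
    have hterm : ∀ i, |𝒯.w i / 2 * (∫ X, v (h.toFun (𝒯.param i X, y))) -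
        𝒯.w i / 2 * (∫ q, v (𝒯.strip i q)) / 2| ≤
        𝒯.w i * (2 * ω + 2 * ‖v‖ * η + 2 * ‖v‖ * endIndicator η y) +
          2 * ‖v‖ * (if 𝒯.s i = 1 then 0 else 𝒯.w i) := by
      intro i
      have hw := 𝒯.w_pos i
      have e : ∀ X, h.toFun (𝒯.param i X, y) = 𝒯.strip i (squareTwist η (𝒯.s i, (X, y))) :=
        fun X => 𝒯.toStripTiling.twistFun_strip η 𝒯.s i (X, y)
      simp only [e]
      rw [mul_div_assoc, ← mul_sub, abs_mul, abs_of_pos (by linarith)]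
      have hω' : ∀ z z', dist z z' ≤ 𝒯.w i → |v z - v z'| ≤ ω := fun z z' hz =>
        hω z z' (hz.trans (𝒯.w_lt i).le)
      have hω0 : 0 ≤ ω := (abs_nonneg _).trans (hω' (0, y) (0, y) (by simpa using hw.le))
      split_ifs with hs
      · rw [hs]
        nlinarith [𝒯.toStripTiling.abs_strip_average_sub_le_of_good v h0 h1 hω' y]
      · have := 𝒯.toStripTiling.abs_strip_average_sub_le (η := η) v i (𝒯.s i) y
        have e2 := mul_nonneg hM (endIndicator_nonneg η y)
        nlinarith [mul_nonneg hM h0.le, mul_le_mul_of_nonneg_left this hw.le,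
          mul_nonneg hw.le hω0, mul_nonneg hw.le e2, mul_nonneg hw.le (mul_nonneg hM h0.le)]
    refine (Finset.abs_sum_le_sum_abs _ _).trans ((Finset.sum_le_sum fun i _ => hterm i).trans ?_)
    rw [Finset.sum_add_distrib, ← Finset.sum_mul, 𝒯.sum_w, ← Finset.mul_sum]
    nlinarith [mul_le_mul_of_nonneg_left 𝒯.sum_bad hM]
  have hJ := (integrable_endIndicator η).const_mul (2 * ‖v‖)
  have hI : Integrable (fun y => ∫ x, v (h.toFun (x, y))) :=
    (integrable_of_continuous (μ := (volume : Measure (AddCircle (1 : ℝ))).prod volume)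
      (f := fun z => v (h.toFun z)) (by fun_prop)).integral_prod_right
  refine (integral_mono (hI.sub (integrable_const _)).abs ((integrable_const _).add hJ) hpt).trans ?_
  simp only [Pi.add_apply]
  rw [integral_add (integrable_const _) hJ, integral_const, integral_const_mul,
      integral_endIndicator h0 h1, measureReal_univ_Icc, smul_eq_mul]
  linarith

theorem RampedTiling.exists_le_abs_snd {α δ ε η : ℝ} {ι : Type} [Fintype ι]
    (𝒯 : RampedTiling α δ ε ι) (hε : ε < 1) (h0 : 0 < η) (h1 : η < 1) (y : Icc (-1 : ℝ) 1) :
    ∃ x, 1 - η ≤ |(((𝒯.toStripTiling.twist η 𝒯.s).toFun (x, y)).2 : ℝ)| := by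
  obtain ⟨i, hi⟩ : ∃ i, 𝒯.s i = 1 := by
    by_contra! h
    have := 𝒯.sum_bad
    simp only [h, if_false, 𝒯.sum_w] at this
    linarith
  have e : ∀ X, (𝒯.toStripTiling.twist η 𝒯.s).toFun (𝒯.param i X, y) =
      𝒯.strip i (squareTwist η (𝒯.s i, (X, y))) :=
    fun X => 𝒯.toStripTiling.twistFun_strip η 𝒯.s i (X, y)
  by_cases hy : |(y : ℝ)| ≤ 1 - η
  · have hX : |1 - η| = 1 - η := abs_of_pos (by linarith)
    refine ⟨𝒯.param i ⟨1 - η, by linarith, by linarith⟩, ?_⟩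
    rw [e, hi, squareTwist_one h0 (max_le hX.le hy)]
    exact hX.symm.le
  · refine ⟨𝒯.param i ⟨1, by norm_num, le_rfl⟩, ?_⟩
    rw [e, squareTwist_of_radius_eq_one _ (squareRadius_eq_one_of_fst (by simp))]
    exact (not_le.1 hy).le

/-- There are homeomorphisms almost commuting with an irrational rotation and sending
most circles `y = const` to nearly equidistributed curves. -/
theorem exists_liftedHomeo_equidistributing {α : ℝ} (hα : Irrational α) (v : C(Annulus, ℝ)) {ε : ℝ}
    (hε : 0 < ε) : ∃ h : LiftedHomeo,
      (∀ z, dist (h.toFun (annulusRotation α z)) (annulusRotation α (h.toFun z)) ≤ ε) ∧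
      (∀ z, |h.disp z| ≤ ε) ∧
      ∫ y, |(∫ x, v (h.toFun (x, y))) - (∫ z, v z) / 2| ≤ ε ∧
      ∀ y, ∃ x, 1 - ε ≤ |((h.toFun (x, y)).2 : ℝ)| := by
  have hM := norm_nonneg v
  obtain ⟨κ, hκ, hv⟩ := Metric.uniformContinuous_iff.1
    (CompactSpace.uniformContinuous_of_continuous v.continuous) (ε / 12) (by positivity)
  obtain ⟨η, hη0, hη⟩ : ∃ η > 0, η < min (1 / 2) (min ε (ε / (24 * (‖v‖ + 1)))) :=
    exists_between (by positivity)
  obtain ⟨γ, hγ0, hγ⟩ : ∃ γ > 0, γ < min (min (1 / 2) κ) (min (ε / 2) (ε / (12 * (‖v‖ + 1)))) :=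
    exists_between (by positivity)
  simp only [lt_min_iff] at hη hγ
  obtain ⟨hη1, hη2, hη3⟩ := hη
  obtain ⟨⟨hγ1, hγ2⟩, hγ3, hγ4⟩ := hγ
  rw [lt_div_iff₀ (by positivity)] at hη3 hγ4
  obtain ⟨δ, hδ, hT⟩ := exists_dist_squareTwist_le η hε
  obtain ⟨ι, _, ⟨𝒯⟩⟩ := exists_rampedTiling hα hδ hγ0
  refine ⟨𝒯.toStripTiling.twist η 𝒯.s, 𝒯.dist_twist_rotation_le hT hε.le (by linarith),
    fun z => (𝒯.toStripTiling.abs_twist_disp_le η 𝒯.s 𝒯.w_lt z).trans (by linarith), ?_, fun y => ?_⟩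
  · refine (𝒯.integral_abs_average_sub_le v hη0 (by linarith) (ω := ε / 12)
      fun z z' hz => (hv (hz.trans_lt hγ2)).le).trans ?_
    nlinarith
  · obtain ⟨x, hx⟩ := 𝒯.exists_le_abs_snd (by linarith) hη0 (by linarith) y
    exact ⟨x, by linarith⟩

theorem fourier_coe_ne_one {α : ℝ} (hα : Irrational α) {k : ℤ} (hk : k ≠ 0) :
    fourier k (α : AddCircle (1 : ℝ)) ≠ 1 := by
  intro h
  rw [fourier_coe_apply, Complex.exp_eq_one_iff] at h
  obtain ⟨n, hn⟩ := h
  have h2 : (2 * Real.pi * Complex.I : ℂ) ≠ 0 := Complex.two_pi_I_ne_zero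
  have h3 : ((k * α : ℝ) : ℂ) = ((n : ℝ) : ℂ) := by
    refine mul_left_cancel₀ h2 ?_
    push_cast
    rw [mul_comm _ (n : ℂ), ← hn]
    push_cast
    ring
  exact (hα.intCast_mul hk).ne_int n (by exact_mod_cast h3)

theorem fourier_add_right (k : ℤ) (x y : AddCircle (1 : ℝ)) :
    fourier k (x + y) = fourier k x * fourier k y := by
  simp [fourier_apply, smul_add, AddCircle.toCircle_add]

theorem integral_fourier_eq_zero {α : ℝ} (hα : Irrational α) {k : ℤ} (hk : k ≠ 0) :
    ∫ x : AddCircle (1 : ℝ), fourier k x = 0 := by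
  have h := integral_add_right_eq_self (μ := (volume : Measure (AddCircle (1 : ℝ))))
    (fun x => fourier k x) (α : AddCircle (1 : ℝ))
  simp only [fourier_add_right] at h
  rw [integral_mul_const] at h
  have h1 := fourier_coe_ne_one hα hk
  by_contra h0
  exact h1 (mul_left_cancel₀ h0 (by rw [h, mul_one]))

open Filter Topology in
/-- The Weyl equidistribution theorem for complex-valued functions. -/
theorem tendsto_average_rotation_complex {α : ℝ} (hα : Irrational α)
    (f : C(AddCircle (1 : ℝ), ℂ)) (x : AddCircle (1 : ℝ)) :
    Tendsto (fun N : ℕ => (N : ℂ)⁻¹ * ∑ n ∈ Finset.range N, f (x + n • (α : AddCircle (1 : ℝ))))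
      atTop (𝓝 (∫ y, f y)) := by
  set a := (α : AddCircle (1 : ℝ))
  have hinteg : ∀ g : C(AddCircle (1 : ℝ), ℂ), Integrable g volume := fun g =>
    g.continuous.integrable_of_hasCompactSupport (HasCompactSupport.of_compactSpace g)
  have hspan : ∀ g ∈ Submodule.span ℂ (range (@fourier 1)),
      Tendsto (fun N : ℕ => (N : ℂ)⁻¹ * ∑ n ∈ Finset.range N, g (x + n • a))
        atTop (𝓝 (∫ y, g y)) := by
    intro g hg
    induction hg using Submodule.span_induction with
    | mem g hg =>
      obtain ⟨k, rfl⟩ := hg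
      by_cases hk : k = 0
      · subst hk
        refine tendsto_const_nhds.congr' ?_
        filter_upwards [eventually_gt_atTop 0] with N hN
        have : (N : ℂ) ≠ 0 := by exact_mod_cast hN.ne'
        simp [measureReal_univ_addCircle, this]
      · rw [integral_fourier_eq_zero hα hk]
        have hz := fourier_coe_ne_one hα hk
        set z := fourier k a
        have hpow : ∀ n : ℕ, fourier k (n • a) = z ^ n := by
          intro n
          induction n with
          | zero => simp
          | succ n ih => rw [succ_nsmul, fourier_add_right, ih, pow_succ]
        have hnorm : ∀ t : AddCircle (1 : ℝ), ‖fourier k t‖ = 1 := fun t => by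
          rw [fourier_apply]
          exact Circle.norm_coe _
        simp only [fourier_add_right, hpow, ← Finset.mul_sum, geom_sum_eq hz]
        refine squeeze_zero_norm (a := fun N : ℕ => (N : ℝ)⁻¹ * (2 / ‖z - 1‖)) (fun N => ?_) ?_
        · rw [norm_mul, norm_mul, hnorm, one_mul, norm_div, norm_inv, Complex.norm_natCast]
          gcongr
          refine (norm_sub_le _ _).trans ?_
          rw [norm_pow, hnorm, one_pow, norm_one]
          norm_num
        · simpa using (tendsto_inv_atTop_nhds_zero_nat (𝕜 := ℝ)).mul_const (2 / ‖z - 1‖)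
    | zero => simp
    | add g g' _ _ h h' =>
      have e := integral_add (hinteg g) (hinteg g')
      simp only [ContinuousMap.add_apply, Finset.sum_add_distrib, mul_add]
      rw [e]
      exact h.add h'
    | smul c g _ h =>
      simp only [ContinuousMap.smul_apply, smul_eq_mul, ← Finset.mul_sum, mul_left_comm _ c]
      rw [integral_const_mul]
      exact h.const_mul c
  have hdense : f ∈ closure (Submodule.span ℂ (range (@fourier 1)) : Set C(AddCircle (1 : ℝ), ℂ)) := by
    rw [← Submodule.topologicalClosure_coe, span_fourier_closure_eq_top]
    trivial
  rw [Metric.tendsto_atTop]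
  intro ε hε
  obtain ⟨g, hg, hfg⟩ := Metric.mem_closure_iff.1 hdense (ε / 3) (by positivity)
  obtain ⟨N₀, hN₀⟩ := Metric.tendsto_atTop.1 (hspan g hg) (ε / 3) (by positivity)
  have hpt : ∀ y, ‖f y - g y‖ ≤ ε / 3 := fun y => by
    rw [← dist_eq_norm]; exact (ContinuousMap.dist_apply_le_dist y).trans hfg.le
  refine ⟨N₀ + 1, fun N hN => ?_⟩
  have h1 := hN₀ N (by omega)
  have hNpos : (0 : ℝ) < N := by exact_mod_cast (by omega : 0 < N)
  have h2 : ‖(N : ℂ)⁻¹ * ∑ n ∈ Finset.range N, f (x + n • a) -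
      (N : ℂ)⁻¹ * ∑ n ∈ Finset.range N, g (x + n • a)‖ ≤ ε / 3 := by
    rw [← mul_sub, ← Finset.sum_sub_distrib, norm_mul, norm_inv, Complex.norm_natCast,
      inv_mul_le_iff₀ hNpos]
    refine (norm_sum_le_of_le _ fun n _ => hpt _).trans ?_
    simp
  have h3 : ‖(∫ y, g y) - ∫ y, f y‖ ≤ ε / 3 := by
    rw [← integral_sub (hinteg g) (hinteg f)]
    refine (norm_integral_le_of_norm_le_const (C := ε / 3)
      (Eventually.of_forall fun y => ?_)).trans ?_
    · rw [norm_sub_rev]; exact hpt y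
    · rw [measureReal_univ_addCircle, mul_one]
  rw [dist_eq_norm] at h1 ⊢
  calc _ = ‖((N : ℂ)⁻¹ * ∑ n ∈ Finset.range N, f (x + n • a) -
      (N : ℂ)⁻¹ * ∑ n ∈ Finset.range N, g (x + n • a)) +
      ((N : ℂ)⁻¹ * ∑ n ∈ Finset.range N, g (x + n • a) - ∫ y, g y) +
      ((∫ y, g y) - ∫ y, f y)‖ := by congr 1; ring
    _ ≤ _ := norm_add₃_le
    _ < ε := by linarith

open Filter Topology in
/-- The Weyl equidistribution theorem. -/
theorem tendsto_average_rotation {α : ℝ} (hα : Irrational α)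
    {f : AddCircle (1 : ℝ) → ℝ} (hf : Continuous f) (x : AddCircle (1 : ℝ)) :
    Tendsto (fun N : ℕ => (N : ℝ)⁻¹ * ∑ n ∈ Finset.range N, f (x + n • (α : AddCircle (1 : ℝ))))
      atTop (𝓝 (∫ y, f y)) := by
  have h := tendsto_average_rotation_complex hα ⟨fun y => (f y : ℂ), by fun_prop⟩ x
  have h2 := (Complex.continuous_re.tendsto _).comp h
  simp only [ContinuousMap.coe_mk] at h2
  rw [integral_complex_ofReal, Complex.ofReal_re] at h2
  refine h2.congr fun N => ?_
  simp only [Function.comp_apply]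
  rw [← Complex.ofReal_re ((N : ℝ)⁻¹ * _)]
  push_cast
  rfl

/-- A self-map of the annulus, a candidate inverse and a candidate displacement of a lift. -/
abbrev MapTriple := C(Annulus, Annulus) × C(Annulus, Annulus) × C(Annulus, ℝ)

/-- The rotation by `α`, its inverse, and the displacement of its lift. -/
def rotationTriple (α : ℝ) : MapTriple :=
  (annulusRotation α, annulusRotation (-α), ContinuousMap.const _ α)

theorem dist_annulusRotation (β : ℝ) (z w : Annulus) :
    dist (annulusRotation β z) (annulusRotation β w) = dist z w := by
  simp [annulusRotation_apply, Prod.dist_eq]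

theorem annulusRotation_neg_annulusRotation (β : ℝ) (z : Annulus) :
    annulusRotation (-β) (annulusRotation β z) = z := by
  simp [annulusRotation_apply]

theorem annulusRotation_annulusRotation_neg (β : ℝ) (z : Annulus) :
    annulusRotation β (annulusRotation (-β) z) = z := by
  simp [annulusRotation_apply]

namespace LiftedHomeo

variable (k h : LiftedHomeo) {α ε : ℝ}

/-- Conjugation of a triple by a lifted homeomorphism. -/
def conj (t : MapTriple) : MapTriple :=
  ((k.toFun.comp t.1).comp k.inv, (k.toFun.comp t.2.1).comp k.inv,
    (k.disp.comp t.1 + t.2.2 - k.disp).comp k.inv)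

theorem conj_conj (t : MapTriple) : k.conj (h.conj t) = (k.comp h).conj t := by
  refine Prod.ext ?_ (Prod.ext ?_ ?_) <;> ext1 z
  · rfl
  · rfl
  · simp only [conj, comp, ContinuousMap.comp_apply, ContinuousMap.add_apply,
      ContinuousMap.sub_apply, h.toFun_inv]
    ring

theorem continuous_conj : Continuous k.conj := by
  unfold conj
  fun_prop

theorem dist_conj_rotationTriple_le (hε : 0 ≤ ε)
    (h1 : ∀ z, dist (h.toFun (annulusRotation α z)) (annulusRotation α (h.toFun z)) ≤ ε)
    (h2 : ∀ z, |h.disp z| ≤ ε) :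
    dist (h.conj (rotationTriple α)) (rotationTriple α) ≤ 2 * ε := by
  have h0 : (0 : ℝ) ≤ 2 * ε := by positivity
  refine max_le ?_ (max_le ?_ ?_) <;> refine (ContinuousMap.dist_le h0).2 fun z => ?_
  · have := h1 (h.inv z)
    rw [h.toFun_inv] at this
    exact this.trans (by linarith)
  · have := h1 (annulusRotation (-α) (h.inv z))
    rw [annulusRotation_annulusRotation_neg, h.toFun_inv,
      ← dist_annulusRotation (-α), annulusRotation_neg_annulusRotation, dist_comm] at this
    exact this.trans (by linarith)
  · have e1 := abs_le.1 (h2 (annulusRotation α (h.inv z)))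
    have e2 := abs_le.1 (h2 (h.inv z))
    simp only [conj, rotationTriple, ContinuousMap.comp_apply, ContinuousMap.add_apply,
      ContinuousMap.sub_apply, ContinuousMap.const_apply, Real.dist_eq]
    rw [abs_le]
    constructor <;> linarith

end LiftedHomeo

/-- The conjugacy class of the rotation by `α`. -/
def rotationClass (α : ℝ) : Set MapTriple := range fun h : LiftedHomeo => h.conj (rotationTriple α)

theorem conj_mem_closure_rotationClass_inter {α : ℝ} {O : Set MapTriple} (k : LiftedHomeo)
    (H : ∀ ε > 0, ∃ h : LiftedHomeo,
      (∀ z, dist (h.toFun (annulusRotation α z)) (annulusRotation α (h.toFun z)) ≤ ε) ∧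
      (∀ z, |h.disp z| ≤ ε) ∧ (k.comp h).conj (rotationTriple α) ∈ O) :
    k.conj (rotationTriple α) ∈ closure (rotationClass α ∩ O) := by
  rw [Metric.mem_closure_iff]
  intro δ hδ
  obtain ⟨γ, hγ, hk⟩ := Metric.continuous_iff.1 k.continuous_conj (rotationTriple α) δ hδ
  obtain ⟨h, h1, h2, h3⟩ := H (γ / 4) (by positivity)
  refine ⟨_, ⟨⟨k.comp h, rfl⟩, h3⟩, ?_⟩
  dsimp only
  rw [dist_comm, ← LiftedHomeo.conj_conj]
  exact hk _ ((h.dist_conj_rotationTriple_le (by positivity) h1 h2).trans_lt (by linarith))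

/-- Iterates of a continuous map. -/
def iter (a : C(Annulus, Annulus)) : ℕ → C(Annulus, Annulus)
  | 0 => ContinuousMap.id _
  | n + 1 => a.comp (iter a n)

theorem continuous_iter (n : ℕ) : Continuous fun a => iter a n := by
  induction n with
  | zero => exact continuous_const
  | succ n ih => exact continuous_id.compCM ih

theorem iter_eq_iterate (a : C(Annulus, Annulus)) (n : ℕ) : ⇑(iter a n) = a^[n] := by
  induction n with
  | zero => rfl
  | succ n ih =>
    rw [Function.iterate_succ', ← ih]
    rfl

/-- Birkhoff averages. -/
def avg (a : C(Annulus, Annulus)) (u : C(Annulus, ℝ)) (N : ℕ) : C(Annulus, ℝ) :=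
  (N : ℝ)⁻¹ • ∑ n ∈ Finset.range N, u.comp (iter a n)

theorem avg_apply (a : C(Annulus, Annulus)) (u : C(Annulus, ℝ)) (N : ℕ) (z : Annulus) :
    avg a u N z = (N : ℝ)⁻¹ * ∑ n ∈ Finset.range N, u (iter a n z) := by
  simp [avg]

theorem continuous_avg (N : ℕ) :
    Continuous fun p : C(Annulus, Annulus) × C(Annulus, ℝ) => avg p.1 p.2 N := by
  unfold avg
  have h : ∀ n, Continuous fun p : C(Annulus, Annulus) × C(Annulus, ℝ) => p.2.comp (iter p.1 n) :=
    fun n => continuous_snd.compCM ((continuous_iter n).comp continuous_fst)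
  fun_prop

theorem abs_avg_le (a : C(Annulus, Annulus)) (u : C(Annulus, ℝ)) (N : ℕ) (z : Annulus) :
    |avg a u N z| ≤ ‖u‖ := by
  rw [avg_apply, abs_mul, abs_inv, Nat.abs_cast]
  rcases N.eq_zero_or_pos with rfl | hN
  · simp
  · have : (0 : ℝ) < N := by exact_mod_cast hN
    rw [inv_mul_le_iff₀ this]
    refine (Finset.abs_sum_le_sum_abs _ _).trans ?_
    refine (Finset.sum_le_sum fun n _ => u.norm_coe_le_norm (iter a n z)).trans ?_
    simp

theorem iter_conj_rotationTriple (g : LiftedHomeo) (α : ℝ) (n : ℕ) (w : Annulus) :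
    iter (g.conj (rotationTriple α)).1 n (g.toFun w) =
      g.toFun (w.1 + n • (α : AddCircle (1 : ℝ)), w.2) := by
  induction n with
  | zero => simp [iter]
  | succ n ih =>
    rw [iter, ContinuousMap.comp_apply, ih]
    simp only [LiftedHomeo.conj, rotationTriple, ContinuousMap.comp_apply, g.inv_toFun,
      annulusRotation_apply, succ_nsmul, add_assoc]

theorem continuous_integral_continuousMap :
    Continuous fun u : C(Annulus, ℝ) => ∫ z, u z := by
  refine (LipschitzWith.of_dist_le_mul (K := 2) fun u v => ?_).continuous
  rw [Real.dist_eq, ← integral_sub (integrable_of_continuous u.continuous)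
    (integrable_of_continuous v.continuous), mul_comm, NNReal.coe_ofNat, ← measureReal_univ_annulus]
  refine abs_integral_le_mul fun z => ?_
  rw [← Real.dist_eq]
  exact ContinuousMap.dist_apply_le_dist z

theorem continuous_integral_abs_sub (c : ℝ) :
    Continuous fun u : C(Annulus, ℝ) => ∫ z, |u z - c| :=
  continuous_integral_continuousMap.comp
    (ContinuousMap.continuous_postcomp (⟨fun r => |r - c|, by fun_prop⟩ : C(ℝ, ℝ)))

/-- Triples whose displacement has a Birkhoff average uniformly `ε`-close to `α`. -/
def dispSet (α ε : ℝ) : Set MapTriple :=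
  {t | ∃ N : ℕ, 0 < N ∧ dist (avg t.1 t.2.2 N) (ContinuousMap.const _ α) < ε}

/-- Triples for which some Birkhoff average of `u` is `ε`-close in mean to the mean of `u`. -/
def ergodicSet (u : C(Annulus, ℝ)) (ε : ℝ) : Set MapTriple :=
  {t | ∃ N : ℕ, 0 < N ∧ ∫ z, |avg t.1 u N z - (∫ w, u w) / 2| < ε}

/-- Triples all of whose forward orbits leave `|y| ≤ c`. -/
def escapeSet (c : ℝ) : Set MapTriple :=
  {t | ∀ z, ∃ n : ℕ, c < |((iter t.1 n z).2 : ℝ)|}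

theorem isOpen_dispSet (α ε : ℝ) : IsOpen (dispSet α ε) := by
  have : dispSet α ε = ⋃ N : ℕ, {t | 0 < N ∧ dist (avg t.1 t.2.2 N) (ContinuousMap.const _ α) < ε} := by
    ext t; simp [dispSet]
  rw [this]
  refine isOpen_iUnion fun N => isOpen_const.and ?_
  refine isOpen_lt (((continuous_avg N).comp (by fun_prop :
    Continuous fun t : MapTriple => (t.1, t.2.2))).dist continuous_const) continuous_const

theorem isOpen_ergodicSet (u : C(Annulus, ℝ)) (ε : ℝ) : IsOpen (ergodicSet u ε) := by
  have : ergodicSet u ε =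
      ⋃ N : ℕ, {t | 0 < N ∧ ∫ z, |avg t.1 u N z - (∫ w, u w) / 2| < ε} := by
    ext t; simp [ergodicSet]
  rw [this]
  refine isOpen_iUnion fun N => isOpen_const.and ?_
  exact isOpen_lt ((continuous_integral_abs_sub _).comp ((continuous_avg N).comp (by fun_prop :
    Continuous fun t : MapTriple => (t.1, u)))) continuous_const

theorem isOpen_escapeSet (c : ℝ) : IsOpen (escapeSet c) := by
  rw [isOpen_iff_mem_nhds]
  intro t ht
  have key := isCompact_univ.eventually_forall_of_forall_eventually (x₀ := t)
    (P := fun (t : MapTriple) (z : Annulus) => ∃ n : ℕ, c < |((iter t.1 n z).2 : ℝ)|)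
    (K := univ) (by
      intro z _
      obtain ⟨n, hn⟩ := ht z
      have hc : Continuous fun p : MapTriple × Annulus => |((iter p.1.1 n p.2).2 : ℝ)| := by
        have h1 : Continuous fun p : MapTriple × Annulus => iter p.1.1 n :=
          (continuous_iter n).comp (by fun_prop)
        have h2 : Continuous fun p : MapTriple × Annulus => iter p.1.1 n p.2 :=
          h1.eval continuous_snd
        fun_prop
      filter_upwards [(isOpen_lt continuous_const hc).mem_nhds hn] with p hp
      exact ⟨n, hp⟩)
  filter_upwards [key] with t h z using h z (mem_univ z)

theorem sum_disp_conj_rotationTriple (g : LiftedHomeo) (α : ℝ) (N : ℕ) (w : Annulus) :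
    ∑ n ∈ Finset.range N, (g.conj (rotationTriple α)).2.2
        (iter (g.conj (rotationTriple α)).1 n (g.toFun w)) =
      N * α + g.disp (w.1 + N • (α : AddCircle (1 : ℝ)), w.2) - g.disp w := by
  induction N with
  | zero => simp
  | succ N ih =>
    rw [Finset.sum_range_succ, ih, iter_conj_rotationTriple]
    simp only [LiftedHomeo.conj, rotationTriple, ContinuousMap.comp_apply, g.inv_toFun,
      annulusRotation_apply, ContinuousMap.add_apply, ContinuousMap.sub_apply,
      ContinuousMap.const_apply, succ_nsmul, add_assoc]
    push_cast
    ring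

theorem conj_rotationTriple_mem_dispSet (g : LiftedHomeo) (α : ℝ) {ε : ℝ} (hε : 0 < ε) :
    g.conj (rotationTriple α) ∈ dispSet α ε := by
  obtain ⟨N, hN⟩ := exists_nat_gt (2 * ‖g.disp‖ / (ε / 2))
  have hN0 : (0 : ℝ) < N := lt_of_le_of_lt (by positivity) hN
  rw [div_lt_iff₀ (by positivity)] at hN
  refine ⟨N, by exact_mod_cast hN0, ?_⟩
  refine lt_of_le_of_lt ((ContinuousMap.dist_le (C := ε / 2) (by positivity)).2 fun z => ?_)
    (by linarith)
  rw [← g.toFun_inv z, avg_apply, sum_disp_conj_rotationTriple, ContinuousMap.const_apply,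
    Real.dist_eq]
  set w := g.inv z
  set w' : Annulus := (w.1 + N • (α : AddCircle (1 : ℝ)), w.2)
  have h1 := abs_le.1 (g.disp.norm_coe_le_norm w)
  have h2 := abs_le.1 (g.disp.norm_coe_le_norm w')
  have : (N : ℝ)⁻¹ * (N * α + g.disp w' - g.disp w) - α = (g.disp w' - g.disp w) / N := by
    field_simp
    ring
  rw [this, abs_div, Nat.abs_cast, div_le_iff₀ hN0, abs_le]
  constructor <;> linarith

open Filter Topology in
theorem tendsto_integral_abs_avg_sub {α : ℝ} (hα : Irrational α) (g : LiftedHomeo)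
    (u : C(Annulus, ℝ)) (c : ℝ) :
    Tendsto (fun N => ∫ z, |avg (g.conj (rotationTriple α)).1 u N z - c|) atTop
      (𝓝 (∫ y, |(∫ x, u (g.toFun (x, y))) - c|)) := by
  set a := (g.conj (rotationTriple α)).1
  have h1 : ∀ N, ∫ z, |avg a u N z - c| = ∫ w, |avg a u N (g.toFun w) - c| := by
    intro N
    conv_lhs => rw [← g.measurePreserving.map_eq]
    exact integral_map g.toFun.continuous.aemeasurable
      (by fun_prop : Continuous fun z => |avg a u N z - c|).aestronglyMeasurable
  have h2 : ∫ y, |(∫ x, u (g.toFun (x, y))) - c| =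
      ∫ w : Annulus, |(∫ x, u (g.toFun (x, w.2))) - c| := by
    rw [Measure.volume_eq_prod, integral_fun_snd (fun y => |(∫ x, u (g.toFun (x, y))) - c|),
      measureReal_univ_addCircle, one_smul]
  simp only [h1]
  rw [h2]
  refine tendsto_integral_of_dominated_convergence (fun _ => ‖u‖ + |c|)
    (fun N => (by fun_prop : Continuous fun w => |avg a u N (g.toFun w) - c|).aestronglyMeasurable)
    (integrable_const _) (fun N => Eventually.of_forall fun w => ?_)
    (Eventually.of_forall fun w => ?_)
  · rw [Real.norm_eq_abs, abs_abs]
    exact (abs_sub _ _).trans (add_le_add_left (abs_avg_le _ _ _ _) _)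
  · have := tendsto_average_rotation hα (f := fun x => u (g.toFun (x, w.2))) (by fun_prop) w.1
    refine (this.sub_const c).abs.congr fun N => ?_
    simp only [avg_apply, a, iter_conj_rotationTriple]

open Filter Topology in
theorem rotationClass_subset_closure_inter_ergodicSet {α : ℝ} (hα : Irrational α)
    (u : C(Annulus, ℝ)) {ε : ℝ} (hε : 0 < ε) :
    rotationClass α ⊆ closure (rotationClass α ∩ ergodicSet u ε) := by
  rintro _ ⟨k, rfl⟩
  refine conj_mem_closure_rotationClass_inter k fun δ hδ => ?_
  obtain ⟨h, h1, h2, h3, -⟩ := exists_liftedHomeo_equidistributing hα (u.comp k.toFun)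
    (ε := min δ (ε / 2)) (by positivity)
  refine ⟨h, fun z => (h1 z).trans (min_le_left _ _), fun z => (h2 z).trans (min_le_left _ _), ?_⟩
  have hu : ∫ z, u (k.toFun z) = ∫ z, u z := by
    conv_rhs => rw [← k.measurePreserving.map_eq]
    exact (integral_map k.toFun.continuous.aemeasurable u.continuous.aestronglyMeasurable).symm
  simp only [ContinuousMap.comp_apply, hu] at h3
  have h4 := tendsto_integral_abs_avg_sub hα (k.comp h) u ((∫ w, u w) / 2)
  have h5 := h4.eventually_lt_const
    (lt_of_le_of_lt (h3.trans (min_le_right _ _)) (by linarith : ε / 2 < ε))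
  obtain ⟨N, hN, hN0⟩ := (h5.and (eventually_gt_atTop 0)).exists
  exact ⟨N, hN0, hN⟩

theorem LiftedHomeo.exists_lt_abs_snd (k : LiftedHomeo) {c : ℝ} (hc : c < 1) :
    ∃ ε > 0, ∀ z : Annulus, 1 - ε ≤ |(z.2 : ℝ)| → c < |((k.toFun z).2 : ℝ)| := by
  have hK : IsCompact {z : Annulus | |((k.toFun z).2 : ℝ)| ≤ c} :=
    (isClosed_le (by fun_prop) continuous_const).isCompact
  obtain ⟨b, hb, hKb⟩ := hK.exists_forall_le' (f := fun z : Annulus => 1 - |(z.2 : ℝ)|) (a := 0)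
    (by fun_prop) fun z hz => sub_pos.2 <| lt_of_le_of_ne (abs_le.2 z.2.2) fun h => by
      have := (k.abs_snd_eq_one z).2 h
      have hz' : |((k.toFun z).2 : ℝ)| ≤ c := hz
      linarith
  refine ⟨b / 2, by linarith, fun z hz => ?_⟩
  by_contra! h
  have := hKb z h
  linarith

theorem rotationClass_subset_closure_inter_escapeSet {α : ℝ} (hα : Irrational α)
    {c : ℝ} (hc : c < 1) :
    rotationClass α ⊆ closure (rotationClass α ∩ escapeSet c) := by
  rintro _ ⟨k, rfl⟩
  refine conj_mem_closure_rotationClass_inter k fun δ hδ => ?_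
  obtain ⟨ε, hε, hk⟩ := k.exists_lt_abs_snd hc
  obtain ⟨h, h1, h2, -, h4⟩ := exists_liftedHomeo_equidistributing hα 0
    (ε := min δ ε) (by positivity)
  refine ⟨h, fun z => (h1 z).trans (min_le_left _ _), fun z => (h2 z).trans (min_le_left _ _),
    fun z => ?_⟩
  rw [← (k.comp h).toFun_inv z]
  set w := (k.comp h).inv z
  obtain ⟨x, hx⟩ := h4 w.2
  have hx' : c < |(((k.comp h).toFun (x, w.2)).2 : ℝ)| :=
    hk _ (le_trans (by linarith [min_le_right δ ε]) hx)
  have ho : IsOpen {y : AddCircle (1 : ℝ) | c < |(((k.comp h).toFun (w.1 + y, w.2)).2 : ℝ)|} :=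
    isOpen_lt continuous_const (by fun_prop)
  obtain ⟨n, hn⟩ := (denseRange_nsmul_of_irrational hα).exists_mem_open ho
    ⟨x - w.1, by simpa using hx'⟩
  refine ⟨n, ?_⟩
  rw [iter_conj_rotationTriple]
  exact hn

/-- A form of the Baire category theorem for the closure of a set. -/
theorem exists_mem_closure_forall_mem {X : Type*} [MetricSpace X] [CompleteSpace X] {ι : Type*}
    [Countable ι] {C : Set X} (hC : C.Nonempty) {O : ι → Set X} (hO : ∀ i, IsOpen (O i))
    (hd : ∀ i, C ⊆ closure (C ∩ O i)) : ∃ x ∈ closure C, ∀ i, x ∈ O i := by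
  have : CompleteSpace (closure C) := isClosed_closure.completeSpace_coe
  have : Nonempty (closure C) := hC.closure.to_subtype
  have hdense : Dense (⋂ i, ((↑) : closure C → X) ⁻¹' O i) := by
    refine dense_iInter_of_isOpen (fun i => (hO i).preimage continuous_subtype_val) fun i => ?_
    rw [Subtype.dense_iff]
    refine closure_minimal ((hd i).trans (closure_mono ?_)) isClosed_closure
    rintro x ⟨hx, hxO⟩
    exact ⟨⟨x, subset_closure hx⟩, hxO, rfl⟩
  obtain ⟨x, hx⟩ := hdense.nonempty
  exact ⟨x, x.2, fun i => mem_iInter.1 hx i⟩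

theorem exists_generic_mapTriple {α : ℝ} (hα : Irrational α) :
    ∃ t ∈ closure (rotationClass α),
      (∀ ε > 0, t ∈ dispSet α ε) ∧
      (∀ c < 1, t ∈ escapeSet c) ∧
      ∃ S : Set C(Annulus, ℝ), Dense S ∧ ∀ u ∈ S, ∀ ε > 0, t ∈ ergodicSet u ε := by
  obtain ⟨S, hSc, hS⟩ := TopologicalSpace.exists_countable_dense C(Annulus, ℝ)
  have : Countable S := hSc.to_subtype
  set e : ℕ → ℝ := fun m => 1 / ((m : ℝ) + 1)
  have he : ∀ m, 0 < e m := fun m => by positivity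
  obtain ⟨t, ht, hO⟩ := exists_mem_closure_forall_mem (C := rotationClass α)
    (ι := ℕ ⊕ ℕ ⊕ S × ℕ)
    (O := Sum.elim (fun m => dispSet α (e m))
      (Sum.elim (fun m => escapeSet (1 - e m)) fun p => ergodicSet p.1 (e p.2)))
    (range_nonempty_iff_nonempty.2 ⟨LiftedHomeo.refl⟩)
    (by
      rintro (m | m | p)
      · exact isOpen_dispSet _ _
      · exact isOpen_escapeSet _
      · exact isOpen_ergodicSet _ _)
    (by
      rintro (m | m | p)
      · refine subset_closure.trans (closure_mono (subset_inter subset_rfl ?_))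
        rintro _ ⟨g, rfl⟩
        exact conj_rotationTriple_mem_dispSet g α (he m)
      · exact rotationClass_subset_closure_inter_escapeSet hα (by linarith [he m])
      · exact rotationClass_subset_closure_inter_ergodicSet hα _ (he p.2))
  refine ⟨t, ht, fun ε hε => ?_, fun c hc z => ?_, S, hS, fun u hu ε hε => ?_⟩
  · obtain ⟨m, hm⟩ := exists_nat_one_div_lt hε
    obtain ⟨N, hN0, hN⟩ := hO (Sum.inl m)
    exact ⟨N, hN0, hN.trans hm⟩
  · obtain ⟨m, hm⟩ := exists_nat_one_div_lt (sub_pos.2 hc)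
    obtain ⟨n, hn⟩ := hO (Sum.inr (Sum.inl m)) z
    have hm' : e m < 1 - c := hm
    exact ⟨n, by linarith⟩
  · obtain ⟨m, hm⟩ := exists_nat_one_div_lt hε
    obtain ⟨N, hN0, hN⟩ := hO (Sum.inr (Sum.inr (⟨u, hu⟩, m)))
    exact ⟨N, hN0, hN.trans hm⟩

section Closure

variable {α : ℝ} {t : MapTriple}

theorem forall_mem_of_mem_closure_rotationClass {A : Set MapTriple} (hA : IsClosed A)
    (h : ∀ g : LiftedHomeo, g.conj (rotationTriple α) ∈ A)
    (ht : t ∈ closure (rotationClass α)) : t ∈ A :=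
  closure_minimal (range_subset_iff.2 h) hA ht

theorem fst_snd_apply_of_mem_closure (ht : t ∈ closure (rotationClass α)) (z : Annulus) :
    t.1 (t.2.1 z) = z := by
  refine forall_mem_of_mem_closure_rotationClass (A := {t : MapTriple | t.1 (t.2.1 z) = z})
    (isClosed_eq (by fun_prop) continuous_const) (fun g => ?_) ht
  change _ = _
  simp only [LiftedHomeo.conj, rotationTriple, ContinuousMap.comp_apply, g.inv_toFun,
    annulusRotation_annulusRotation_neg, g.toFun_inv]

theorem snd_fst_apply_of_mem_closure (ht : t ∈ closure (rotationClass α)) (z : Annulus) :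
    t.2.1 (t.1 z) = z := by
  refine forall_mem_of_mem_closure_rotationClass (A := {t : MapTriple | t.2.1 (t.1 z) = z})
    (isClosed_eq (by fun_prop) continuous_const) (fun g => ?_) ht
  change _ = _
  simp only [LiftedHomeo.conj, rotationTriple, ContinuousMap.comp_apply, g.inv_toFun,
    annulusRotation_neg_annulusRotation, g.toFun_inv]

theorem fst_apply_eq_of_mem_closure (ht : t ∈ closure (rotationClass α)) (z : Annulus) :
    (t.1 z).1 = z.1 + (t.2.2 z : AddCircle (1 : ℝ)) := by
  refine forall_mem_of_mem_closure_rotationClass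
    (A := {t : MapTriple | (t.1 z).1 = z.1 + (t.2.2 z : AddCircle (1 : ℝ))})
    (isClosed_eq (by fun_prop) (continuous_const.add
      ((AddCircle.continuous_mk' 1).comp (by fun_prop)))) (fun g => ?_) ht
  change _ = _
  have h := g.fst_toFun (g.inv z)
  rw [g.toFun_inv] at h
  simp only [LiftedHomeo.conj, rotationTriple, ContinuousMap.comp_apply, g.fst_toFun,
    ContinuousMap.add_apply, ContinuousMap.sub_apply, ContinuousMap.const_apply]
  rw [h]
  simp only [annulusRotation_apply, AddCircle.coe_add, AddCircle.coe_sub]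
  abel

theorem measurePreserving_annulusRotation (β : ℝ) :
    MeasurePreserving (annulusRotation β) volume volume :=
  (measurePreserving_add_right volume (β : AddCircle (1 : ℝ))).prod (MeasurePreserving.id _)

theorem LiftedHomeo.measurePreserving_inv (g : LiftedHomeo) :
    MeasurePreserving g.inv volume volume := by
  refine ⟨g.inv.continuous.measurable, ?_⟩
  conv_lhs => rw [← g.measurePreserving.map_eq]
  rw [Measure.map_map g.inv.continuous.measurable g.toFun.continuous.measurable,
    show ⇑g.inv ∘ ⇑g.toFun = id from funext g.inv_toFun, Measure.map_id]

theorem measurePreserving_of_mem_closure (ht : t ∈ closure (rotationClass α)) :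
    MeasurePreserving t.1 volume volume := by
  refine measurePreserving_of_integral_comp_eq t.1 fun u => ?_
  refine forall_mem_of_mem_closure_rotationClass
    (A := {t : MapTriple | ∫ z, u (t.1 z) = ∫ z, u z})
    (isClosed_eq ?_ continuous_const) (fun g => ?_) ht
  · exact continuous_integral_continuousMap.comp
      ((ContinuousMap.continuous_postcomp u).comp continuous_fst)
  · have h : MeasurePreserving (g.conj (rotationTriple α)).1 volume volume :=
      (g.measurePreserving.comp (measurePreserving_annulusRotation α)).comp g.measurePreserving_inv
    change _ = _
    conv_rhs => rw [← h.map_eq]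
    exact (integral_map h.measurable.aemeasurable u.continuous.aestronglyMeasurable).symm

end Closure

section Averages

variable {a : C(Annulus, Annulus)} {μ : Measure Annulus} {φ : Annulus → ℝ}

theorem measurePreserving_iter (ha : MeasurePreserving a μ μ) (n : ℕ) :
    MeasurePreserving (iter a n) μ μ := by
  rw [iter_eq_iterate]
  exact ha.iterate n

theorem integrable_comp_iter (ha : MeasurePreserving a μ μ) (hφ : Integrable φ μ) (n : ℕ) :
    Integrable (fun z => φ (iter a n z)) μ :=
  (measurePreserving_iter ha n).integrable_comp_of_integrable hφ

theorem integrable_average (ha : MeasurePreserving a μ μ) (hφ : Integrable φ μ) (N : ℕ) :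
    Integrable (fun z => (N : ℝ)⁻¹ * ∑ n ∈ Finset.range N, φ (iter a n z)) μ :=
  (integrable_finsetSum _ fun n _ => integrable_comp_iter ha hφ n).const_mul _

theorem integral_average (ha : MeasurePreserving a μ μ) (hφ : Integrable φ μ) {N : ℕ}
    (hN : 0 < N) :
    ∫ z, (N : ℝ)⁻¹ * ∑ n ∈ Finset.range N, φ (iter a n z) ∂μ = ∫ z, φ z ∂μ := by
  have h : ∀ n, ∫ z, φ (iter a n z) ∂μ = ∫ z, φ z ∂μ := fun n => by
    have hn := measurePreserving_iter ha n
    conv_rhs => rw [← hn.map_eq]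
    refine (integral_map hn.measurable.aemeasurable ?_).symm
    rw [hn.map_eq]
    exact hφ.aestronglyMeasurable
  rw [integral_const_mul, integral_finsetSum _ fun n _ => integrable_comp_iter ha hφ n]
  have : (N : ℝ) ≠ 0 := by exact_mod_cast hN.ne'
  simp [h, this]

theorem integral_eq_of_forall_mem_dispSet {α : ℝ} {t : MapTriple} (h : ∀ ε > 0, t ∈ dispSet α ε)
    [IsProbabilityMeasure μ] (ha : MeasurePreserving t.1 μ μ) : ∫ z, t.2.2 z ∂μ = α := by
  refine eq_of_abs_sub_le_all fun ε hε => ?_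
  obtain ⟨N, hN0, hN⟩ := h ε hε
  rw [← integral_average ha (integrable_of_continuous t.2.2.continuous) hN0]
  have e : α = ∫ _, α ∂μ := by simp
  simp only [← avg_apply]
  rw [e, ← integral_sub (integrable_of_continuous (avg _ _ N).continuous) (integrable_const _)]
  refine (abs_integral_le_mul (C := ε) fun z => ?_).trans (by simp)
  rw [← Real.dist_eq]
  exact ((ContinuousMap.dist_apply_le_dist (g := ContinuousMap.const _ α) z).trans hN.le)

theorem abs_sub_average_le (a : C(Annulus, Annulus)) {s : Set Annulus} (hs : a ⁻¹' s = s)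
    (u : C(Annulus, ℝ)) {N : ℕ} (hN : 0 < N) (z : Annulus) :
    |s.indicator 1 z - avg a u N z| ≤
      (N : ℝ)⁻¹ * ∑ n ∈ Finset.range N, |s.indicator 1 (iter a n z) - u (iter a n z)| := by
  have hN' : (N : ℝ) ≠ 0 := by exact_mod_cast hN.ne'
  have h : ∀ n, s.indicator (1 : Annulus → ℝ) (iter a n z) = s.indicator 1 z := fun n => by
    have hs' : (iter a n) ⁻¹' s = s := by
      rw [iter_eq_iterate]
      exact Function.IsFixedPt.preimage_iterate hs n
    conv_rhs => rw [← hs']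
    rfl
  have e : s.indicator (1 : Annulus → ℝ) z =
      (N : ℝ)⁻¹ * ∑ n ∈ Finset.range N, s.indicator (1 : Annulus → ℝ) (iter a n z) := by
    simp [h, hN']
  rw [e, avg_apply, ← mul_sub, ← Finset.sum_sub_distrib, abs_mul, abs_of_nonneg (by positivity)]
  gcongr
  exact Finset.abs_sum_le_sum_abs _ _

theorem exists_mem_integral_abs_sub_le {S : Set C(Annulus, ℝ)} (hS : Dense S)
    (hφ : Integrable φ volume) {ε : ℝ} (hε : 0 < ε) :
    ∃ u ∈ S, ∫ z, |φ z - u z| ≤ ε := by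
  obtain ⟨v, hv, -⟩ := hφ.exists_boundedContinuous_integral_sub_le (half_pos hε)
  obtain ⟨u, hu, huS⟩ := Metric.dense_iff.1 hS v.toContinuousMap (ε / 4) (by positivity)
  refine ⟨u, huS, ?_⟩
  have hvi : Integrable v volume := integrable_of_continuous v.continuous
  have hi : Integrable (fun z => |φ z - v z|) volume := (hφ.sub hvi).abs
  have h2 : ∀ z, |v z - u z| ≤ ε / 4 := fun z => by
    rw [← Real.dist_eq, dist_comm]
    exact (ContinuousMap.dist_apply_le_dist (g := v.toContinuousMap) z).trans hu.le
  calc ∫ z, |φ z - u z| ≤ ∫ z, (|φ z - v z| + ε / 4) := by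
        refine integral_mono (hφ.sub (integrable_of_continuous u.continuous)).abs
          (hi.add (integrable_const _)) fun z => ?_
        exact (abs_sub_le _ (v z) _).trans (by linarith [h2 z])
    _ = (∫ z, |φ z - v z|) + ε / 2 := by
        rw [integral_add hi (integrable_const _), integral_const,
          measureReal_univ_annulus, smul_eq_mul]
        ring
    _ ≤ ε := by
        simp only [Real.norm_eq_abs] at hv
        linarith

theorem preErgodic_of_dense {S : Set C(Annulus, ℝ)} (hS : Dense S)
    (ha : MeasurePreserving a volume volume)
    (h : ∀ u ∈ S, ∀ ε > 0, ∃ N : ℕ, 0 < N ∧ ∫ z, |avg a u N z - (∫ w, u w) / 2| < ε) :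
    PreErgodic a volume := by
  refine ⟨fun s hs hinv => ?_⟩
  set χ : Annulus → ℝ := s.indicator 1
  have hχ : Integrable χ volume := (integrable_const (1 : ℝ)).indicator hs
  set c := (∫ z, χ z) / 2
  have hle : ∫ z, |χ z - c| ≤ 0 := by
    refine le_of_forall_pos_le_add fun ε hε => ?_
    obtain ⟨u, huS, hu⟩ := exists_mem_integral_abs_sub_le hS hχ (by positivity : 0 < ε / 3)
    obtain ⟨N, hN0, hN⟩ := h u huS (ε / 3) (by positivity)
    have hui := integrable_of_continuous (μ := volume) u.continuous
    have hdi := (hχ.sub hui).abs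
    have havg := integrable_of_continuous (μ := volume) (avg a u N).continuous
    have hai : Integrable (fun z => |χ z - avg a u N z|) volume := (hχ.sub havg).abs
    have hbi : Integrable (fun z => |avg a u N z - (∫ w, u w) / 2|) volume :=
      (havg.sub (integrable_const ((∫ w, u w) / 2))).abs
    have h1 : ∫ z, |χ z - avg a u N z| ≤ ε / 3 := by
      refine (integral_mono hai (integrable_average ha hdi N)
        (abs_sub_average_le a hinv u hN0)).trans ?_
      exact (integral_average ha hdi hN0).trans_le hu
    have h2 : |(∫ w, u w) / 2 - c| ≤ ε / 6 := by
      rw [← sub_div, ← integral_sub hui hχ, abs_div, abs_two, div_le_iff₀ two_pos]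
      refine (abs_integral_le_integral_abs).trans ?_
      simp only [abs_sub_comm (u _)]
      linarith
    have hi : Integrable (fun z => |χ z - avg a u N z| + |avg a u N z - (∫ w, u w) / 2|) volume :=
      hai.add hbi
    calc ∫ z, |χ z - c| ≤ ∫ z, (|χ z - avg a u N z| + |avg a u N z - (∫ w, u w) / 2| + ε / 6) := by
          refine integral_mono (hχ.sub (integrable_const c)).abs (hi.add (integrable_const _))
            fun z => ?_
          refine (abs_sub_le _ ((∫ w, u w) / 2) _).trans (add_le_add ?_ h2)
          exact abs_sub_le _ _ _
      _ = (∫ z, |χ z - avg a u N z|) + (∫ z, |avg a u N z - (∫ w, u w) / 2|) + ε / 3 := by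
          rw [integral_add hi (integrable_const _), integral_add hai hbi, integral_const,
            measureReal_univ_annulus, smul_eq_mul]
          ring
      _ ≤ 0 + ε := by linarith
  have hae : ∀ᵐ z, χ z = c := by
    have h0 := (integral_eq_zero_iff_of_nonneg (fun z => abs_nonneg (χ z - c))
      (hχ.sub (integrable_const c)).abs).1
      (le_antisymm hle (integral_nonneg fun z => abs_nonneg _))
    filter_upwards [h0] with z hz
    exact sub_eq_zero.1 (abs_eq_zero.1 hz)
  rw [Filter.eventuallyConst_set]
  by_cases hc : c = 1
  · left
    filter_upwards [hae] with z hz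
    by_contra hzs
    rw [hc, show χ z = 0 from indicator_of_notMem hzs _] at hz
    exact zero_ne_one hz
  · right
    filter_upwards [hae] with z hz hzs
    exact hc (hz ▸ (indicator_of_mem hzs _ : χ z = 1))

end Averages

theorem not_exists_compact_of_forall_mem_escapeSet {t : MapTriple}
    (h : ∀ c < 1, t ∈ escapeSet c) {K : Set Annulus} (hne : K.Nonempty) (hK : IsCompact K)
    (hinv : t.1 '' K = K) : ¬ K ⊆ annulusInt := by
  intro hinteg
  obtain ⟨b, hb, hKb⟩ := hK.exists_forall_le' (f := fun z : Annulus => 1 - |(z.2 : ℝ)|) (a := 0)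
    (by fun_prop) fun z hz => sub_pos.2 (abs_lt.2 (hinteg hz))
  obtain ⟨z, hz⟩ := hne
  obtain ⟨n, hn⟩ := h (1 - b) (by linarith) z
  have hmem : ∀ n, iter t.1 n z ∈ K := fun n => by
    induction n with
    | zero => exact hz
    | succ n ih =>
      rw [← hinv]
      exact mem_image_of_mem _ ih
  have := hKb _ (hmem n)
  linarith

/-- The homeomorphism of the annulus given by a triple. -/
def MapTriple.homeo (t : MapTriple) (h1 : ∀ z, t.1 (t.2.1 z) = z) (h2 : ∀ z, t.2.1 (t.1 z) = z) :
    Annulus ≃ₜ Annulus where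
  toFun := t.1
  invFun := t.2.1
  left_inv := h2
  right_inv := h1
  continuous_toFun := t.1.continuous
  continuous_invFun := t.2.1.continuous

theorem continuous_annulusProj : Continuous annulusProj :=
  ((AddCircle.continuous_mk' 1).comp continuous_fst).prodMk continuous_snd

theorem annulusProj_add_disp {t : MapTriple}
    (h : ∀ z, (t.1 z).1 = z.1 + (t.2.2 z : AddCircle (1 : ℝ))) (z : AnnulusCover) :
    annulusProj (z.1 + t.2.2 (annulusProj z), (t.1 (annulusProj z)).2) = t.1 (annulusProj z) :=
  Prod.ext (by rw [h]; simp [annulusProj]) rfl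

theorem annulusProj_sub_disp {t : MapTriple} (h1 : ∀ z, t.1 (t.2.1 z) = z)
    (h : ∀ z, (t.1 z).1 = z.1 + (t.2.2 z : AddCircle (1 : ℝ))) (z : AnnulusCover) :
    annulusProj (z.1 - t.2.2 (t.2.1 (annulusProj z)), (t.2.1 (annulusProj z)).2) =
      t.2.1 (annulusProj z) := by
  refine Prod.ext ?_ rfl
  have := h (t.2.1 (annulusProj z))
  rw [h1] at this
  rw [← sub_eq_of_eq_add this]
  simp [annulusProj]

/-- The lift of the homeomorphism given by a triple. -/
def MapTriple.lift (t : MapTriple) (h1 : ∀ z, t.1 (t.2.1 z) = z) (h2 : ∀ z, t.2.1 (t.1 z) = z)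
    (h : ∀ z, (t.1 z).1 = z.1 + (t.2.2 z : AddCircle (1 : ℝ))) :
    AnnulusCover ≃ₜ AnnulusCover where
  toFun z := (z.1 + t.2.2 (annulusProj z), (t.1 (annulusProj z)).2)
  invFun z := (z.1 - t.2.2 (t.2.1 (annulusProj z)), (t.2.1 (annulusProj z)).2)
  left_inv z := by
    simp only [annulusProj_add_disp h, h2]
    exact Prod.ext (by simp) rfl
  right_inv z := by
    simp only [annulusProj_sub_disp h1 h, h1]
    exact Prod.ext (by simp) rfl
  continuous_toFun := by
    have := continuous_annulusProj
    fun_prop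
  continuous_invFun := by
    have := continuous_annulusProj
    fun_prop

theorem annulusProj_add_one (z : AnnulusCover) : annulusProj (z.1 + 1, z.2) = annulusProj z :=
  Prod.ext (AddCircle.coe_add_period (1 : ℝ) z.1) rfl

/-- Theorem (2): for every irrational number `α` there is an area-preserving, ergodic NICIS
homeomorphism of the closed annulus with rotation number `α`. -/
theorem stmt_1 (α : ℝ) (hα : Irrational α) :
    ∃ (f : Annulus ≃ₜ Annulus) (ft : AnnulusCover ≃ₜ AnnulusCover),
      MeasurePreserving f volume volume ∧
      IsLift f ft ∧
      NICIS f ∧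
      Ergodic f ((volume (Set.univ : Set Annulus))⁻¹ • volume) ∧
      (∃ F : Annulus → ℝ, Continuous F ∧
        (∀ z : AnnulusCover, F (annulusProj z) = (ft z).1 - z.1) ∧
        ∀ μ : Measure Annulus, IsProbabilityMeasure μ → MeasurePreserving f μ μ →
          ∫ z, F z ∂μ = α) := by
  obtain ⟨t, ht, hdisp, hesc, S, hS, herg⟩ := exists_generic_mapTriple hα
  have h1 := fst_snd_apply_of_mem_closure ht
  have h2 := snd_fst_apply_of_mem_closure ht
  have h3 := fst_apply_eq_of_mem_closure ht
  have hmp := measurePreserving_of_mem_closure ht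
  refine ⟨t.homeo h1 h2, t.lift h1 h2 h3, hmp, ⟨fun z => ?_, fun z => ?_⟩, ?_, ?_, t.2.2,
    t.2.2.continuous, fun z => ?_, fun μ _ hμ => integral_eq_of_forall_mem_dispSet hdisp hμ⟩
  · refine Prod.ext ?_ ?_
    · change z.1 + 1 + t.2.2 (annulusProj (z.1 + 1, z.2)) = z.1 + t.2.2 (annulusProj z) + 1
      rw [annulusProj_add_one]
      ring
    · change (t.1 (annulusProj (z.1 + 1, z.2))).2 = (t.1 (annulusProj z)).2
      rw [annulusProj_add_one]
  · exact (annulusProj_add_disp h3 z).symm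
  · rintro ⟨K, hne, hK, hinv, hinteg⟩
    exact not_exists_compact_of_forall_mem_escapeSet hesc hne hK hinv hinteg
  · have hpre : PreErgodic t.1 volume := preErgodic_of_dense hS hmp fun u hu => herg u hu
    exact { toMeasurePreserving := hmp.smul_measure _
            aeconst_set := fun s hs hinv =>
              (hpre.aeconst_set hs hinv).anti (Measure.ae_smul_measure_le _) }
  · change _ = z.1 + t.2.2 (annulusProj z) - z.1
    ring
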